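/- arXiv:1704.02887 — 3 statements merged into one kernel-verified Lean document; each statement's English description precedes it below -/
import Mathlib

section
/- Let d ≥ 1, let A be an invertible real d×d matrix with |det A| = 1, B = (A⁻¹)ᵀ, and let f ∈ 𝓕 with representing measure μ. Assume ∑_{m∈ℤ^d∖{0}} f(Am) < ∞ (which forces μ({0}) = 0). Then for every z ∈ ℝ^d, ∑_{m∈ℤ^d∖{0}} e^{2πi (Am)·z} f(Am) = ∫_{(0,∞)} ( π^{d/2} t^{−d/2} ∑_{n∈ℤ^d} exp(−(π²/t) |Bn + z|²) − 1 ) dμ(t), with the sum on the left converging absolutely and the integral on the right being finite. -/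
open scoped Real BigOperators
open Complex MeasureTheory

theorem summable_prod_fin_pi {α : Type*} {f : α → ℝ} (hf0 : ∀ a, 0 ≤ f a) (hf : Summable f)
    (d : ℕ) : Summable fun n : Fin d → α => ∏ i, f (n i) := by
  induction d with
  | zero => exact Summable.of_finite
  | succ d ih =>
    rw [← (Fin.consEquiv fun _ => α).summable_iff]
    refine (hf.mul_of_nonneg ih hf0 fun n => Finset.prod_nonneg fun i _ => hf0 _).congr fun p => ?_
    simp [Fin.consEquiv, Fin.prod_univ_succ]

theorem sum_sq_mulVec_le {m n : Type*} [Fintype m] [Fintype n] (M : Matrix m n ℝ) (x : n → ℝ) :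
    ∑ i, M.mulVec x i ^ 2 ≤ (∑ i, ∑ j, M i j ^ 2) * ∑ j, x j ^ 2 := by
  rw [Finset.sum_mul]
  exact Finset.sum_le_sum fun i _ => Finset.sum_mul_sq_le_sq_mul_sq _ _ _

theorem exists_pos_mul_sum_sq_le_sum_sq_mulVec {n : Type*} [Fintype n] [DecidableEq n]
    {M : Matrix n n ℝ} (hM : IsUnit M.det) :
    ∃ δ > 0, ∀ x : n → ℝ, δ * ∑ i, x i ^ 2 ≤ ∑ i, M.mulVec x i ^ 2 := by
  set C := ∑ i, ∑ j, M⁻¹ i j ^ 2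
  have hC : 0 ≤ C := by positivity
  refine ⟨(C + 1)⁻¹, by positivity, fun x => ?_⟩
  have h := sum_sq_mulVec_le M⁻¹ (M.mulVec x)
  rw [Matrix.mulVec_mulVec, Matrix.nonsing_inv_mul _ hM, Matrix.one_mulVec] at h
  rw [inv_mul_le_iff₀ (by positivity)]
  exact h.trans (by gcongr; exact le_add_of_nonneg_right zero_le_one)

theorem summable_exp_neg_mul_int_sq {δ : ℝ} (hδ : 0 < δ) (C : ℝ) :
    Summable fun n : ℤ => Real.exp (-δ * (n : ℝ) ^ 2 + C) := by
  have h := ((summable_jacobiTheta₂_term_iff 0 ((δ / π : ℝ) * I)).mpr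
    (by simpa using div_pos hδ Real.pi_pos)).norm
  simp_rw [Real.exp_add]
  refine (h.congr fun n => ?_).mul_right _
  rw [jacobiTheta₂_term, Complex.norm_exp]
  congr 1
  have : (2 * π * I * n * 0 + π * I * n ^ 2 * ((δ / π : ℝ) * I) : ℂ)
      = ((-δ * (n : ℝ) ^ 2 : ℝ) : ℂ) := by
    push_cast
    have : (π : ℂ) ≠ 0 := by exact_mod_cast Real.pi_ne_zero
    field_simp
    linear_combination (n : ℂ) ^ 2 * δ * I_sq
  rw [this, ofReal_re]

theorem exists_summable_bound_gaussian_shift {d : ℕ} {M : Matrix (Fin d) (Fin d) ℝ}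
    (hM : IsUnit M.det) {c : ℝ} (hc : 0 < c) (R : ℝ) :
    ∃ u : (Fin d → ℤ) → ℝ, Summable u ∧ ∀ n, ∀ w : Fin d → ℝ, ‖w‖ ≤ R →
      Real.exp (-c * ∑ i, M.mulVec (w + fun j => (n j : ℝ)) i ^ 2) ≤ u n := by
  obtain ⟨δ, hδ, h⟩ := exists_pos_mul_sum_sq_le_sum_sq_mulVec hM
  refine ⟨_, summable_prod_fin_pi (fun a => (Real.exp_pos _).le)
    (summable_exp_neg_mul_int_sq (δ := c * δ / 2) (by positivity) (c * δ * R ^ 2)) d,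
    fun n w hw => ?_⟩
  rw [← Real.exp_sum]
  refine Real.exp_le_exp.mpr ?_
  have h1 : ∑ i, ((n i : ℝ) ^ 2 / 2 - R ^ 2) ≤ ∑ i, (w + fun j => (n j : ℝ)) i ^ 2 := by
    refine Finset.sum_le_sum fun i _ => ?_
    have h2 : |w i| ≤ R := (norm_le_pi_norm w i).trans hw
    have h3 := sq_le_sq' (abs_le.mp h2).1 (abs_le.mp h2).2
    simp only [Pi.add_apply]
    nlinarith [sq_nonneg (2 * w i + n i)]
  have h4 := mul_le_mul_of_nonneg_left h1 (by positivity : 0 ≤ c * δ)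
  have h5 := mul_le_mul_of_nonneg_left (h (w + fun j => (n j : ℝ))) hc.le
  have h6 : ∑ i, (-(c * δ / 2) * (n i : ℝ) ^ 2 + c * δ * R ^ 2)
      = -(c * δ * ∑ i, ((n i : ℝ) ^ 2 / 2 - R ^ 2)) := by
    rw [Finset.mul_sum, ← Finset.sum_neg_distrib]
    exact Finset.sum_congr rfl fun i _ => by ring
  rw [h6]
  linarith

theorem summable_gaussian_mulVec_int {d : ℕ} {M : Matrix (Fin d) (Fin d) ℝ}
    (hM : IsUnit M.det) {c : ℝ} (hc : 0 < c) :
    Summable fun n : Fin d → ℤ =>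
      Real.exp (-c * ∑ i, M.mulVec (fun j => (n j : ℝ)) i ^ 2) := by
  obtain ⟨u, hu, h⟩ := exists_summable_bound_gaussian_shift hM hc 0
  exact hu.of_nonneg_of_le (fun n => (Real.exp_pos _).le)
    fun n => by simpa using h n 0 (by simp)

theorem continuous_tsum_gaussian_shift {d : ℕ} {M : Matrix (Fin d) (Fin d) ℝ}
    (hM : IsUnit M.det) {c : ℝ} (hc : 0 < c) :
    Continuous fun w : Fin d → ℝ => ∑' n : Fin d → ℤ,
      Real.exp (-c * ∑ i, M.mulVec (w + fun j => (n j : ℝ)) i ^ 2) := by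
  refine continuous_iff_continuousAt.mpr fun w => ?_
  obtain ⟨u, hu, h⟩ := exists_summable_bound_gaussian_shift hM hc (‖w‖ + 1)
  refine (continuousOn_tsum (s := Metric.ball 0 (‖w‖ + 1)) (fun n => ?_) hu
    fun n x hx => ?_).continuousAt (Metric.isOpen_ball.mem_nhds (by simp))
  · exact Continuous.continuousOn (by unfold Matrix.mulVec dotProduct; fun_prop)
  · rw [Real.norm_of_nonneg (Real.exp_pos _).le]
    exact h n x (by simpa using (Metric.mem_ball.mp hx).le)

theorem hasSum_setIntegral_unit_cube {d : ℕ} {E : Type*} [NormedAddCommGroup E]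
    [NormedSpace ℝ E] {h : (Fin d → ℝ) → E} (hh : Integrable h) :
    HasSum (fun n : Fin d → ℤ =>
      ∫ x in {x : Fin d → ℝ | ∀ i, x i ∈ Set.Ioc (0 : ℝ) (0 + 1)}, h (x + fun j => (n j : ℝ)))
      (∫ x, h x) := by
  let Q : (Fin d → ℤ) → Set (Fin d → ℝ) :=
    fun n => {x | ∀ i, x i ∈ Set.Ioc (n i : ℝ) (n i + 1)}
  have hm : ∀ n, MeasurableSet (Q n) := fun n => MeasurableSet.univ_pi' fun _ => measurableSet_Ioc
  have hU : ⋃ n, Q n = Set.univ := by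
    refine Set.eq_univ_of_forall fun x => Set.mem_iUnion.mpr ⟨fun i => ⌈x i⌉ - 1, fun i => ?_⟩
    have h1 := Int.ceil_lt_add_one (x i)
    have h2 := Int.le_ceil (x i)
    simp only [Set.mem_Ioc]
    push_cast
    constructor <;> linarith
  have hd : Pairwise (Function.onFun Disjoint Q) := by
    refine fun m n hmn => Set.disjoint_left.mpr fun x hx hy => hmn (funext fun i => ?_)
    have h1 := hx i
    have h2 := hy i
    have h3 : (m i : ℝ) < n i + 1 := h1.1.trans_le h2.2
    have h4 : (n i : ℝ) < m i + 1 := h2.1.trans_le h1.2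
    norm_cast at h3 h4
    omega
  have key := hasSum_integral_iUnion hm hd (f := h) hh.integrableOn
  rw [hU, setIntegral_univ] at key
  refine key.congr_fun fun n => ?_
  refine Eq.trans ?_ ((measurePreserving_add_right volume
    (fun j => (n j : ℝ))).setIntegral_preimage_emb (measurableEmbedding_addRight _) h (Q n))
  congr 2
  ext x
  simp [Q, add_comm (n _ : ℝ) 1]

theorem poisson_summation_pi {d : ℕ} {g : (Fin d → ℝ) → ℂ} (hg : Integrable g)
    (hcont : Continuous fun w : Fin d → ℝ => ∑' n : Fin d → ℤ, g (w + fun j => (n j : ℝ)))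
    {c : (Fin d → ℤ) → ℂ} (hc : Summable c)
    (hgc : ∀ m, ∫ w, Complex.exp (-(2 * π * I * ∑ i, (m i : ℂ) * (w i : ℂ))) * g w = c m)
    (w : Fin d → ℝ) :
    HasSum (fun m => Complex.exp (2 * π * I * ∑ i, (m i : ℂ) * (w i : ℂ)) * c m)
      (∑' n : Fin d → ℤ, g (w + fun j => (n j : ℝ))) := by
  set P := fun w : Fin d → ℝ => ∑' n : Fin d → ℤ, g (w + fun j => (n j : ℝ)) with hP
  let q : (Fin d → ℝ) → UnitAddTorus (Fin d) := Pi.map fun _ x => (x : UnitAddCircle)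
  have hq : IsOpenQuotientMap q := .piMap fun _ => QuotientAddGroup.isOpenQuotientMap_mk
  have hper : ∀ x y, q x = q y → P x = P y := by
    intro x y hxy
    have h1 : ∀ i, ∃ k : ℤ, x i = y i + k := fun i => by
      have h2 : (x i : UnitAddCircle) = (y i : UnitAddCircle) := congrFun hxy i
      rw [← sub_eq_zero, ← AddCircle.coe_sub, AddCircle.coe_eq_zero_iff] at h2
      obtain ⟨k, hk⟩ := h2
      exact ⟨k, by simp only [zsmul_eq_mul, mul_one] at hk; linarith⟩
    choose k hk using h1
    rw [hP]
    simp only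
    rw [← (Equiv.addLeft k).tsum_eq (fun n : Fin d → ℤ => g (y + fun j => (n j : ℝ)))]
    refine tsum_congr fun n => congrArg g (funext fun i => ?_)
    simp [hk i, add_assoc]
  let F : C(UnitAddTorus (Fin d), ℂ) :=
    ⟨fun t => P (Function.surjInv hq.surjective t), by
      rw [hq.isQuotientMap.continuous_iff]
      exact hcont.congr fun x => hper _ _ (Function.surjInv_eq hq.surjective _).symm⟩
  have hF : ∀ x, F (q x) = P x := fun x => hper _ _ (Function.surjInv_eq hq.surjective _)
  have hmF : ∀ (m : Fin d → ℤ) (x : Fin d → ℝ), UnitAddTorus.mFourier m (q x)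
      = Complex.exp (2 * π * I * ∑ i, (m i : ℂ) * (x i : ℂ)) := by
    intro m x
    simp only [UnitAddTorus.mFourier, ContinuousMap.coe_mk, q, Pi.map_apply, fourier_coe_apply]
    rw [← Complex.exp_sum, Finset.mul_sum]
    congr 1
    refine Finset.sum_congr rfl fun i _ => ?_
    push_cast
    ring
  have hcoeff : ∀ m, UnitAddTorus.mFourierCoeff F m = c m := by
    intro m
    let h : (Fin d → ℝ) → ℂ :=
      fun x => Complex.exp (-(2 * π * I * ∑ i, (m i : ℂ) * (x i : ℂ))) * g x
    have hnorm : ∀ x, ‖h x‖ = ‖g x‖ := by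
      intro x
      have h1 : (-(2 * π * I * ∑ i, (m i : ℂ) * (x i : ℂ)) : ℂ)
          = ((-(2 * π * ∑ i, (m i : ℝ) * x i) : ℝ) : ℂ) * I := by
        push_cast
        ring
      simp only [h, norm_mul, h1, Complex.norm_exp_ofReal_mul_I, one_mul]
    have hh : Integrable h := by
      refine hg.congr' ?_ (.of_forall fun x => (hnorm x).symm)
      exact (Continuous.aestronglyMeasurable (by fun_prop)).mul hg.1
    have hshift : ∀ (n : Fin d → ℤ) x, h (x + fun j => (n j : ℝ))
        = UnitAddTorus.mFourier (-m) (q x) * g (x + fun j => (n j : ℝ)) := by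
      intro n x
      simp only [h]
      congr 1
      rw [hmF]
      refine Complex.exp_eq_exp_iff_exists_int.mpr ⟨-∑ i, m i * n i, ?_⟩
      push_cast
      simp only [Pi.add_apply, Pi.neg_apply, ofReal_add, ofReal_intCast, mul_add,
        Finset.sum_add_distrib, Int.cast_neg, neg_mul, Finset.sum_neg_distrib]
      ring
    have h1 := hasSum_integral_of_summable_integral_norm
      (μ := volume.restrict {x : Fin d → ℝ | ∀ i, x i ∈ Set.Ioc (0 : ℝ) (0 + 1)})
      (F := fun (n : Fin d → ℤ) x => h (x + fun j => (n j : ℝ)))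
      (fun n => (hh.comp_add_right _).integrableOn)
      (hasSum_setIntegral_unit_cube hh.norm).summable
    rw [← hgc m, (hasSum_setIntegral_unit_cube hh).unique h1,
      UnitAddTorus.mFourierCoeff_eq_integral _ _ 0]
    simp only [hshift, tsum_mul_left]
    exact integral_congr_ae (.of_forall fun x =>
      congrArg (UnitAddTorus.mFourier (-m) (q x) * ·) (hF x))
  have h1 := UnitAddTorus.hasSum_mFourier_series_apply_of_summable (f := F)
    (hc.congr fun m => (hcoeff m).symm) (q w)
  rw [hF] at h1
  refine h1.congr_fun fun m => ?_
  rw [hmF, hcoeff, smul_eq_mul, mul_comm]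

theorem measurePreserving_mulVec {n : Type*} [Fintype n] [DecidableEq n] {M : Matrix n n ℝ}
    (hM : |M.det| = 1) :
    MeasurePreserving (fun x : n → ℝ => M.mulVec x) := by
  have h0 : M.det ≠ 0 := fun h => by simp [h] at hM
  refine ⟨by unfold Matrix.mulVec dotProduct; fun_prop, ?_⟩
  have h := Real.map_matrix_volume_pi_eq_smul_volume_pi h0
  rw [abs_inv, hM, inv_one, ENNReal.ofReal_one, one_smul] at h
  exact h

theorem gaussian_poisson_summation {d : ℕ} {A : Matrix (Fin d) (Fin d) ℝ} (hdet : |A.det| = 1)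
    {t : ℝ} (ht : 0 < t) (z : Fin d → ℝ) :
    HasSum (fun m : Fin d → ℤ =>
      Complex.exp (2 * (π : ℂ) * I * ((∑ i, A.mulVec (fun j => (m j : ℝ)) i * z i : ℝ) : ℂ)) *
        (Real.exp (-(∑ i, A.mulVec (fun j => (m j : ℝ)) i ^ 2) * t) : ℂ))
      ((π ^ ((d : ℝ) / 2) * t ^ (-(d : ℝ) / 2) * ∑' n : Fin d → ℤ, Real.exp (-(π ^ 2 / t) *
        ∑ i, (A⁻¹.transpose.mulVec (fun j => (n j : ℝ)) i + z i) ^ 2) : ℝ) : ℂ) := by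
  have hA : IsUnit A.det := isUnit_iff_ne_zero.mpr fun h => by simp [h] at hdet
  set B := A⁻¹.transpose with hB
  have hBdet : |B.det| = 1 := by
    rw [hB, Matrix.det_transpose, Matrix.det_nonsing_inv, Ring.inverse_eq_inv', abs_inv, hdet,
      inv_one]
  have hBu : IsUnit B.det := isUnit_iff_ne_zero.mpr fun h => by simp [h] at hBdet
  have hBA : B * A.transpose = 1 := by
    rw [hB, ← Matrix.transpose_mul, Matrix.mul_nonsing_inv _ hA, Matrix.transpose_one]
  have hAB : A.transpose * B = 1 := by
    rw [hB, ← Matrix.transpose_mul, Matrix.nonsing_inv_mul _ hA, Matrix.transpose_one]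
  set K : ℝ := π ^ ((d : ℝ) / 2) * t ^ (-(d : ℝ) / 2) with hK
  have hb : 0 < π ^ 2 / t := by positivity
  have hbc : 0 < ((π ^ 2 / t : ℝ) : ℂ).re := by simpa only [ofReal_re] using hb
  let g : (Fin d → ℝ) → ℂ := fun x =>
    ((K * Real.exp (-(π ^ 2 / t) * ∑ i, B.mulVec x i ^ 2) : ℝ) : ℂ)
  let G : (Fin d → ℂ) → (Fin d → ℝ) → ℂ := fun c v =>
    Complex.exp (-((π ^ 2 / t : ℝ) : ℂ) * ∑ i, (v i : ℂ) ^ 2 + ∑ i, c i * v i)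
  have hG : ∀ c, Continuous (G c) := fun c => by fun_prop
  have hmp := measurePreserving_mulVec hBdet
  have hg : Integrable g := by
    have h := ((hmp.integrable_comp (hG 0).aestronglyMeasurable).mpr
      (GaussianFourier.integrable_cexp_neg_mul_sum_add hbc 0)).const_mul (K : ℂ)
    refine h.congr (.of_forall fun x => ?_)
    simp [g, G]
  have hcont : Continuous fun w : Fin d → ℝ =>
      ∑' n : Fin d → ℤ, g (w + fun j => (n j : ℝ)) := by
    simp only [g, ← ofReal_tsum, tsum_mul_left]
    exact continuous_ofReal.comp ((continuous_tsum_gaussian_shift hBu hb).const_mul K)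
  have hdot : ∀ (m : Fin d → ℤ) (w : Fin d → ℝ), ∑ i, (m i : ℝ) * w i
      = ∑ i, A.mulVec (fun j => (m j : ℝ)) i * B.mulVec w i := by
    intro m w
    change dotProduct (fun j => (m j : ℝ)) w
      = dotProduct (A.mulVec fun j => (m j : ℝ)) (B.mulVec w)
    rw [← Matrix.vecMul_transpose, ← Matrix.dotProduct_mulVec, Matrix.mulVec_mulVec, hAB,
      Matrix.one_mulVec]
  have hconst : (K : ℂ) * ((π : ℂ) / ((π ^ 2 / t : ℝ) : ℂ)) ^ ((Fintype.card (Fin d) : ℂ) / 2)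
      = 1 := by
    rw [Fintype.card_fin]
    have h1 : ((π : ℂ) / ((π ^ 2 / t : ℝ) : ℂ)) ^ ((d : ℂ) / 2)
        = (((π / (π ^ 2 / t)) ^ ((d : ℝ) / 2) : ℝ) : ℂ) := by
      rw [ofReal_cpow (by positivity)]
      push_cast
      rfl
    rw [h1, ← ofReal_mul, ← ofReal_one, ofReal_inj, hK,
      show π / (π ^ 2 / t) = t / π by field_simp, Real.div_rpow ht.le Real.pi_pos.le, neg_div,
      Real.rpow_neg ht.le]
    field_simp
  have hgc : ∀ m : Fin d → ℤ,
      ∫ w, Complex.exp (-(2 * π * I * ∑ i, (m i : ℂ) * (w i : ℂ))) * g w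
        = (Real.exp (-(∑ i, A.mulVec (fun j => (m j : ℝ)) i ^ 2) * t) : ℂ) := by
    intro m
    let c : Fin d → ℂ := fun i => -(2 * π * I * (A.mulVec (fun j => (m j : ℝ)) i : ℂ))
    have h1 : ∀ w : Fin d → ℝ, Complex.exp (-(2 * π * I * ∑ i, (m i : ℂ) * (w i : ℂ))) * g w
        = K * G c (B.mulVec w) := by
      intro w
      have h2 : (∑ i, (m i : ℂ) * (w i : ℂ)) =
          ∑ i, (A.mulVec (fun j => (m j : ℝ)) i : ℂ) * (B.mulVec w i : ℂ) := by
        exact_mod_cast hdot m w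
      simp only [g, G, c, h2, Complex.exp_add, neg_mul, Finset.sum_neg_distrib, mul_assoc,
        ← Finset.mul_sum]
      push_cast
      ring
    simp_rw [h1]
    rw [integral_const_mul, ← integral_map (f := G c) hmp.aemeasurable
      (hG c).aestronglyMeasurable, hmp.map_eq,
      GaussianFourier.integral_cexp_neg_mul_sum_add hbc c, ← mul_assoc, hconst, one_mul, ofReal_exp]
    congr 1
    have h3 : ∑ i, c i ^ 2
        = -(4 * π ^ 2) * ∑ i, (A.mulVec (fun j => (m j : ℝ)) i : ℂ) ^ 2 := by
      rw [Finset.mul_sum]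
      refine Finset.sum_congr rfl fun i _ => ?_
      simp only [c]
      linear_combination (4 * π ^ 2 * (A.mulVec (fun j => (m j : ℝ)) i : ℂ) ^ 2) * I_sq
    rw [h3]
    push_cast
    have := ofReal_ne_zero.mpr ht.ne'
    have := ofReal_ne_zero.mpr Real.pi_ne_zero
    field_simp
  have hsum : Summable fun m : Fin d → ℤ =>
      (Real.exp (-(∑ i, A.mulVec (fun j => (m j : ℝ)) i ^ 2) * t) : ℂ) := by
    rw [Complex.summable_ofReal]
    exact (summable_gaussian_mulVec_int hA ht).congr fun m => by ring_nf
  have hBw : B.mulVec (A.transpose.mulVec z) = z := by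
    rw [Matrix.mulVec_mulVec, hBA, Matrix.one_mulVec]
  have key := poisson_summation_pi hg hcont hsum hgc (A.transpose.mulVec z)
  convert key using 1
  · funext m
    congr 3
    have h := hdot m (A.transpose.mulVec z)
    rw [hBw] at h
    rw [← h]
    push_cast
    rfl
  · simp only [g, ← ofReal_tsum, tsum_mul_left, Matrix.mulVec_add, hBw, Pi.add_apply]
    simp only [add_comm]

theorem integrable_tsum_of_summable_integral_norm {α ι : Type*} [MeasurableSpace α] [Countable ι]
    {μ : Measure α} {F : ι → α → ℂ} (hF : ∀ i, Integrable (F i) μ)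
    (hsum : Summable fun i => ∫ a, ‖F i a‖ ∂μ) : Integrable (fun a => ∑' i, F i a) μ := by
  refine ⟨(AEMeasurable.tsum fun i => (hF i).aemeasurable).aestronglyMeasurable, ?_⟩
  calc ∫⁻ a, ‖∑' i, F i a‖ₑ ∂μ ≤ ∫⁻ a, ∑' i, ‖F i a‖ₑ ∂μ :=
        lintegral_mono fun a => enorm_tsum_le_tsum_enorm
    _ = ∑' i, ENNReal.ofReal (∫ a, ‖F i a‖ ∂μ) := by
        rw [lintegral_tsum fun i => (hF i).1.enorm]
        exact tsum_congr fun i => (ofReal_integral_norm_eq_lintegral_enorm (hF i)).symm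
    _ < ⊤ := by
        rw [← ENNReal.ofReal_tsum_of_nonneg (fun i => by positivity) hsum]
        exact ENNReal.ofReal_lt_top

theorem tsum_subtype_ne_of_hasSum {β E : Type*} [NormedAddCommGroup E] [CompleteSpace E]
    {g : β → E} {a : E} (h : HasSum g a) (b : β) : ∑' m : {m // m ≠ b}, g m = a - g b := by
  have h1 := h.summable.tsum_subtype_add_tsum_subtype_compl {b}
  rw [h.tsum_eq, tsum_singleton b g] at h1
  exact eq_sub_of_add_eq' h1

/-- For `f ∈ 𝓕` with representing measure `μ`, a unit-density lattice `X = Aℤ^d` with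
dual `X* = Bℤ^d`, and summable `f` on `X∖{0}` (which forces `μ({0}) = 0`), one has for
every `z ∈ ℝ^d`:
`∑_{m≠0} e^{2πi(Am)·z} f(Am) = ∫_{(0,∞)} (π^{d/2} t^{−d/2} θ_{X*+z}(π/t) − 1) dμ(t)`,
with the sum absolutely convergent and the integral finite. -/
theorem dual_energy_theta_representation (d : ℕ) (hd : 1 ≤ d)
    (A : Matrix (Fin d) (Fin d) ℝ) (hA : IsUnit A.det) (hdet : |A.det| = 1)
    (B : Matrix (Fin d) (Fin d) ℝ) (hB : B = A⁻¹.transpose)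
    (μ : Measure ℝ) (f : (Fin d → ℝ) → ℝ)
    (hμf : ∀ x : Fin d → ℝ, x ≠ 0 →
      IntegrableOn (fun t : ℝ => Real.exp (-(∑ i, x i ^ 2) * t)) (Set.Ici 0) μ)
    (hf : ∀ x : Fin d → ℝ, x ≠ 0 →
      f x = ∫ t in Set.Ici 0, Real.exp (-(∑ i, x i ^ 2) * t) ∂μ)
    (hsum : Summable fun m : {m : Fin d → ℤ // m ≠ 0} => f (A.mulVec fun j => (m.1 j : ℝ)))
    (z : Fin d → ℝ) :
    μ {0} = 0 ∧
    Summable (fun m : {m : Fin d → ℤ // m ≠ 0} =>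
      ‖Complex.exp (2 * (π : ℂ) * Complex.I *
          ((∑ i, A.mulVec (fun j => (m.1 j : ℝ)) i * z i : ℝ) : ℂ)) *
        (f (A.mulVec fun j => (m.1 j : ℝ)) : ℂ)‖) ∧
    IntegrableOn (fun t : ℝ =>
      π ^ ((d : ℝ) / 2) * t ^ (-(d : ℝ) / 2) *
        (∑' n : Fin d → ℤ,
          Real.exp (-(π ^ 2 / t) * ∑ i, (B.mulVec (fun j => (n j : ℝ)) i + z i) ^ 2)) - 1)
      (Set.Ioi 0) μ ∧
    (∑' m : {m : Fin d → ℤ // m ≠ 0},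
        Complex.exp (2 * (π : ℂ) * Complex.I *
            ((∑ i, A.mulVec (fun j => (m.1 j : ℝ)) i * z i : ℝ) : ℂ)) *
          (f (A.mulVec fun j => (m.1 j : ℝ)) : ℂ)) =
      ((∫ t in Set.Ioi 0,
        (π ^ ((d : ℝ) / 2) * t ^ (-(d : ℝ) / 2) *
          (∑' n : Fin d → ℤ,
            Real.exp (-(π ^ 2 / t) * ∑ i, (B.mulVec (fun j => (n j : ℝ)) i + z i) ^ 2)) - 1) ∂μ : ℝ) : ℂ) := by
  subst hB
  set S := {m : Fin d → ℤ // m ≠ 0}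
  let v : (Fin d → ℤ) → Fin d → ℝ := fun m => A.mulVec fun j => (m j : ℝ)
  have hv : ∀ m : S, v m.1 ≠ 0 := by
    intro m h
    have h1 : (fun j => (m.1 j : ℝ)) = 0 :=
      Matrix.mulVec_injective_of_isUnit ((Matrix.isUnit_iff_isUnit_det A).mpr hA)
        (h.trans (Matrix.mulVec_zero A).symm)
    exact m.2 (funext fun j => by simpa using congrFun h1 j)
  have : NeZero d := ⟨by omega⟩
  have : Infinite S := by
    refine Infinite.of_injective (fun k : ℕ => (⟨fun _ => (k : ℤ) + 1, fun h => ?_⟩ : S)) ?_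
    · have := congrFun h 0
      simp only [Pi.zero_apply] at this
      omega
    · intro k l h
      have := congrFun (congrArg Subtype.val h) 0
      simpa using this
  have hμ0 : μ {0} = 0 := by
    have hle : ∀ m : S, μ {0} ≤ ENNReal.ofReal (f (v m.1)) := by
      intro m
      rw [hf _ (hv m), ofReal_integral_eq_lintegral_ofReal (hμf _ (hv m))
        (.of_forall fun t => (Real.exp_pos _).le)]
      calc μ {0} = ∫⁻ t in {0}, ENNReal.ofReal (Real.exp (-(∑ i, v m.1 i ^ 2) * t)) ∂μ := by
            simp
        _ ≤ _ := lintegral_mono_set (by simp)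
    have h := ENNReal.tendsto_ofReal hsum.tendsto_cofinite_zero
    rw [ENNReal.ofReal_zero] at h
    exact le_zero_iff.mp (ge_of_tendsto' h hle)
  have hres : μ.restrict (Set.Ici 0) = μ.restrict (Set.Ioi 0) :=
    (Measure.restrict_congr_set (Ioi_ae_eq_Ici' hμ0)).symm
  let e : (Fin d → ℤ) → ℂ := fun m =>
    Complex.exp (2 * (π : ℂ) * I * ((∑ i, v m i * z i : ℝ) : ℂ))
  have he : ∀ m, ‖e m‖ = 1 := fun m => by
    rw [← Complex.norm_exp_ofReal_mul_I (2 * π * ∑ i, v m i * z i)]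
    simp only [e]
    congr 2
    push_cast
    ring
  have hf0 : ∀ m : S, 0 ≤ f (v m.1) := fun m => by
    rw [hf _ (hv m)]
    exact integral_nonneg fun t => (Real.exp_pos _).le
  let F : S → ℝ → ℂ := fun m t => e m.1 * (Real.exp (-(∑ i, v m.1 i ^ 2) * t) : ℂ)
  have hF : ∀ m, IntegrableOn (F m) (Set.Ioi 0) μ := fun m => by
    have h := hμf _ (hv m)
    rw [IntegrableOn, hres] at h
    exact h.ofReal.const_mul _
  have hFnorm : ∀ m : S, ∫ t in Set.Ioi 0, ‖F m t‖ ∂μ = f (v m.1) := fun m => by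
    rw [hf _ (hv m), hres]
    simp only [F, norm_mul, he, one_mul, Complex.norm_real, Real.norm_eq_abs, Real.abs_exp]
  have hFint : ∀ m : S, ∫ t in Set.Ioi 0, F m t ∂μ = e m.1 * (f (v m.1) : ℂ) := fun m => by
    rw [hf _ (hv m), hres]
    simp only [F]
    rw [integral_const_mul, integral_complex_ofReal]
  have hFsum : Summable fun m => ∫ t in Set.Ioi 0, ‖F m t‖ ∂μ :=
    hsum.congr fun m => (hFnorm m).symm
  set H : ℝ → ℝ := fun t => π ^ ((d : ℝ) / 2) * t ^ (-(d : ℝ) / 2) *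
        (∑' n : Fin d → ℤ,
          Real.exp (-(π ^ 2 / t) *
            ∑ i, (A⁻¹.transpose.mulVec (fun j => (n j : ℝ)) i + z i) ^ 2)) - 1 with hH
  have hFH : ∀ t ∈ Set.Ioi (0 : ℝ), ∑' m, F m t = (H t : ℂ) := by
    intro t ht
    have h := gaussian_poisson_summation hdet ht z
    have h0 : e 0 * (Real.exp (-(∑ i, v 0 i ^ 2) * t) : ℂ) = 1 := by
      have hv0 : v 0 = 0 := (congrArg A.mulVec (funext fun j => by simp)).trans A.mulVec_zero
      simp [e, hv0]
    rw [hH, ofReal_sub, ofReal_one, ← h0]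
    exact tsum_subtype_ne_of_hasSum h 0
  have hFH' : (fun t => ∑' m, F m t) =ᵐ[μ.restrict (Set.Ioi 0)] fun t => (H t : ℂ) :=
    (ae_restrict_mem measurableSet_Ioi).mono hFH
  refine ⟨hμ0, hsum.congr fun m => ?_, ?_, ?_⟩
  · rw [norm_mul, Complex.norm_real, Real.norm_of_nonneg (hf0 m)]
    exact (by rw [he m.1, one_mul] : f (v m.1) = ‖e m.1‖ * f (v m.1))
  · have h := (integrable_tsum_of_summable_integral_norm hF hFsum).congr hFH'
    exact (h.re.congr (.of_forall fun t => by simp) : Integrable H _)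
  · rw [← integral_complex_ofReal, ← integral_congr_ae hFH',
      ← integral_tsum_of_summable_integral_norm hF hFsum]
    exact tsum_congr fun m => (hFint m).symm
end

section
/- Let d ≥ 1, let A be an invertible real d×d matrix with |det A| = 1, B = (A⁻¹)ᵀ, and let f ∈ 𝓕 with ∑_{m∈ℤ^d∖{0}} f(Am) < ∞. Suppose z₀ ∈ ℝ^d satisfies: for every α > 0 and every z ∈ ℝ^d, ∑_{n∈ℤ^d} exp(−πα|Bn + z₀|²) ≤ ∑_{n∈ℤ^d} exp(−πα|Bn + z|²); and suppose Nz₀ ∈ Bℤ^d for some integer N ≥ 2. Then there exists c > 0 such that φ*(m) := c·cos(2π (Am)·z₀) is N-periodic and satisfies the normalization N^{−d} ∑_{y∈K_N} φ*(y)² = 1, and for every integer M ≥ 1 and every M-periodic ψ : ℤ^d → ℝ satisfying M^{−d} ∑_{y∈K_M} ψ(y)² = 1, one has E_{X,f}[φ*] ≤ E_{X,f}[ψ]. -/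
open scoped Real BigOperators
open MeasureTheory

section Poisson

open Set UnitAddTorus

variable {ι : Type*}

lemma mFourier_coe [Fintype ι] (m : ι → ℤ) (x : ι → ℝ) :
    mFourier m (fun i => (x i : UnitAddCircle)) = Real.fourierChar (∑ i, (m i : ℝ) * x i) := by
  simp only [mFourier, ContinuousMap.coe_mk, fourier_coe_apply, Real.fourierChar_apply,
    ← Complex.exp_sum]
  congr 1
  push_cast
  simp only [Finset.mul_sum, Finset.sum_mul]
  exact Finset.sum_congr rfl fun i _ => by ring

lemma isOpenQuotientMap_coe_unitAddTorus :
    IsOpenQuotientMap (fun (x : ι → ℝ) (i : ι) => (x i : UnitAddCircle)) :=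
  IsOpenQuotientMap.piMap fun _ => QuotientAddGroup.isOpenQuotientMap_mk

lemma pairwise_disjoint_unitCube :
    Pairwise (Function.onFun Disjoint
      fun n : ι → ℤ => {x : ι → ℝ | ∀ i, x i ∈ Ioc (n i : ℝ) (n i + 1)}) := by
  intro m n hmn
  refine Set.disjoint_left.2 fun x hm hn => hmn (funext fun i => ?_)
  have h1 := hm i
  have h2 := hn i
  simp only [mem_Ioc] at h1 h2
  have h3 : (m i : ℝ) < n i + 1 := by linarith
  have h4 : (n i : ℝ) < m i + 1 := by linarith
  norm_cast at h3 h4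
  lia

lemma iUnion_unitCube :
    ⋃ n : ι → ℤ, {x : ι → ℝ | ∀ i, x i ∈ Ioc (n i : ℝ) (n i + 1)} = univ := by
  refine eq_univ_of_forall fun x => mem_iUnion.2 ⟨fun i => ⌈x i⌉ - 1, fun i => ?_⟩
  have := Int.ceil_lt_add_one (x i)
  have := Int.le_ceil (x i)
  constructor <;> push_cast <;> linarith

lemma measurableSet_unitCube [Fintype ι] (a : ι → ℝ) :
    MeasurableSet {x : ι → ℝ | ∀ i, x i ∈ Ioc (a i) (a i + 1)} :=
  MeasurableSet.univ_pi' fun _ => measurableSet_Ioc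

lemma hasSum_setIntegral_unitCube [Fintype ι] {h : (ι → ℝ) → ℂ} (hh : Integrable h) :
    HasSum (fun n : ι → ℤ => ∫ x in {x : ι → ℝ | ∀ i, x i ∈ Ioc (0 : ℝ) (0 + 1)},
      h (x + fun i => (n i : ℝ))) (∫ x, h x) := by
  have := hasSum_integral_iUnion (f := h) (μ := volume)
    (fun n : ι → ℤ => measurableSet_unitCube (fun i => (n i : ℝ))) pairwise_disjoint_unitCube
    hh.integrableOn
  rw [iUnion_unitCube, setIntegral_univ] at this
  refine this.congr_fun fun n => ?_
  rw [← (measurePreserving_add_right volume (fun i => (n i : ℝ))).setIntegral_preimage_emb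
    (measurableEmbedding_addRight _) h]
  congr 2
  ext x
  simp only [mem_ofPred_eq, mem_preimage, Pi.add_apply, mem_Ioc]
  exact forall_congr' fun i => by constructor <;> rintro ⟨h1, h2⟩ <;> constructor <;> linarith

/-- The Poisson summation formula on `ι → ℝ`. -/
theorem hasSum_fourier_tsum_translates [Fintype ι] {g : (ι → ℝ) → ℂ} (hc : Continuous g)
    (hi : Integrable g)
    (hb : ∀ R : ℝ, ∃ u : (ι → ℤ) → ℝ, Summable u ∧
      ∀ (n : ι → ℤ) (x : ι → ℝ), ‖x‖ ≤ R → ‖g (x + fun i => (n i : ℝ))‖ ≤ u n)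
    (hs : Summable fun m : ι → ℤ => ∫ y, (Real.fourierChar (-∑ i, (m i : ℝ) * y i) : ℂ) * g y)
    (x : ι → ℝ) :
    HasSum (fun m : ι → ℤ => (∫ y, (Real.fourierChar (-∑ i, (m i : ℝ) * y i) : ℂ) * g y) *
      Real.fourierChar (∑ i, (m i : ℝ) * x i)) (∑' n : ι → ℤ, g (x + fun i => (n i : ℝ))) := by
  set F : (ι → ℝ) → ℂ := fun x => ∑' n : ι → ℤ, g (x + fun i => (n i : ℝ)) with hF
  have hsumg (x : ι → ℝ) : Summable fun n : ι → ℤ => g (x + fun i => (n i : ℝ)) := by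
    obtain ⟨u, hu, hgu⟩ := hb ‖x‖
    exact .of_norm_bounded hu fun n => hgu n x le_rfl
  have hFc : Continuous F := by
    refine continuous_iff_continuousAt.2 fun x => ?_
    obtain ⟨u, hu, hgu⟩ := hb (‖x‖ + 1)
    refine (continuousOn_tsum (s := Metric.ball 0 (‖x‖ + 1)) (fun n => by fun_prop) hu
      fun n y hy => hgu n y (mem_ball_zero_iff.1 hy).le).continuousAt ?_
    exact Metric.isOpen_ball.mem_nhds (by simp)
  have hFper (x : ι → ℝ) (k : ι → ℤ) : F (x + fun i => (k i : ℝ)) = F x := by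
    simp only [hF]
    rw [← (Equiv.addLeft k).tsum_eq fun n : ι → ℤ => g (x + fun i => (n i : ℝ))]
    refine tsum_congr fun n => congrArg g (funext fun i => ?_)
    simp [add_assoc]
  let r : UnitAddTorus ι → ι → ℝ := fun y i => (AddCircle.equivIoc 1 0 (y i) : ℝ)
  have hr (y : UnitAddTorus ι) : (fun i => (r y i : UnitAddCircle)) = y :=
    funext fun i => (AddCircle.equivIoc 1 0).symm_apply_apply (y i)
  have hlift (x : ι → ℝ) : F (r fun i => (x i : UnitAddCircle)) = F x := by
    have h1 (i : ι) : ∃ k : ℤ, (r (fun i => (x i : UnitAddCircle)) i) = x i + k := by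
      have h2 := congrFun (hr fun i => (x i : UnitAddCircle)) i
      rw [eq_comm, ← sub_eq_zero, ← AddCircle.coe_sub, AddCircle.coe_eq_zero_iff] at h2
      obtain ⟨k, hk⟩ := h2
      refine ⟨-k, ?_⟩
      push_cast
      simp only [zsmul_eq_mul, mul_one] at hk
      linarith
    choose k hk using h1
    rw [← hFper x k]
    exact congrArg F (funext hk)
  let Φ : C(UnitAddTorus ι, ℂ) := ⟨fun y => F (r y), by
    rw [isOpenQuotientMap_coe_unitAddTorus.isQuotientMap.continuous_iff]
    exact hFc.congr fun x => (hlift x).symm⟩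
  have hcoeff (m : ι → ℤ) : mFourierCoeff Φ m =
      ∫ y, (Real.fourierChar (-∑ i, (m i : ℝ) * y i) : ℂ) * g y := by
    have hec : Continuous fun y : ι → ℝ => (Real.fourierChar (-∑ i, (m i : ℝ) * y i) : ℂ) := by
      fun_prop
    have heg : Integrable fun y : ι → ℝ =>
        (Real.fourierChar (-∑ i, (m i : ℝ) * y i) : ℂ) * g y :=
      hi.bdd_mul hec.aestronglyMeasurable (c := 1) (.of_forall fun y => (Circle.norm_coe _).le)
    have hshift (y : ι → ℝ) (n : ι → ℤ) :
        (Real.fourierChar (-∑ i, (m i : ℝ) * (y + fun i => (n i : ℝ)) i) : ℂ) =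
          Real.fourierChar (-∑ i, (m i : ℝ) * y i) := by
      have h1 := mFourier_coe (-m) (y + fun i => (n i : ℝ))
      have h2 := mFourier_coe (-m) y
      simp only [Pi.neg_apply, Int.cast_neg, neg_mul, Finset.sum_neg_distrib] at h1 h2
      rw [← h1, ← h2]
      congr 1
      funext i
      simp
    rw [mFourierCoeff_eq_integral _ _ 0, ← (hasSum_setIntegral_unitCube heg).tsum_eq]
    obtain ⟨u, hu, hgu⟩ := hb 1
    set S : Set (ι → ℝ) := {x : ι → ℝ | ∀ i, x i ∈ Ioc (0 : ℝ) (0 + 1)} with hS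
    have hSm : MeasurableSet S := measurableSet_unitCube 0
    have hSn (y : ι → ℝ) (hy : y ∈ S) : ‖y‖ ≤ 1 := by
      refine (pi_norm_le_iff_of_nonneg zero_le_one).2 fun i => ?_
      have := hy i
      simp only [zero_add, mem_Ioc] at this
      rw [Real.norm_eq_abs, abs_le]
      constructor <;> linarith
    have hSv : (volume S) ≠ ⊤ :=
      ((Metric.isBounded_closedBall (x := (0 : ι → ℝ)) (r := 1)).subset fun y hy =>
        mem_closedBall_zero_iff.2 (hSn y hy)).measure_lt_top.ne
    have key := hasSum_integral_of_summable_integral_norm (μ := volume.restrict S)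
      (F := fun (n : ι → ℤ) y => (Real.fourierChar
        (-∑ i, (m i : ℝ) * (y + fun i => (n i : ℝ)) i) : ℂ) * g (y + fun i => (n i : ℝ)))
      (fun n => (heg.comp_add_right _).integrableOn) (by
        refine .of_nonneg_of_le (fun n => integral_nonneg fun y => norm_nonneg _) (fun n => ?_)
          (hu.mul_left (volume.real S))
        refine (setIntegral_mono_on (heg.comp_add_right _).integrableOn.norm
          (integrableOn_const hSv) hSm (g := fun _ => u n) fun y hy => ?_).trans_eq ?_
        · rw [norm_mul, Circle.norm_coe, one_mul]
          exact hgu n y (hSn y hy)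
        · simp)
    rw [key.tsum_eq]
    simp only [Pi.zero_apply]
    refine setIntegral_congr_fun hSm fun y _ => ?_
    simp only [hshift, tsum_mul_left, mFourier_coe, Pi.neg_apply, Int.cast_neg, neg_mul,
      Finset.sum_neg_distrib, smul_eq_mul]
    congr 1
    exact hlift y
  have := hasSum_mFourier_series_apply_of_summable (f := Φ)
    (by rwa [show mFourierCoeff Φ = _ from funext hcoeff]) fun i => (x i : UnitAddCircle)
  simp only [hcoeff, mFourier_coe, smul_eq_mul] at this
  rwa [show Φ (fun i => (x i : UnitAddCircle)) = F x from hlift x] at this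

end Poisson

section Theta

open Matrix

lemma summable_exp_neg_mul_sum_int_sq (d : ℕ) {a : ℝ} (ha : 0 < a) :
    Summable fun n : Fin d → ℤ => Real.exp (-a * ∑ i, (n i : ℝ) ^ 2) := by
  induction d with
  | zero => exact Summable.of_finite
  | succ d ih =>
    have h1 : Summable fun n : ℤ => Real.exp (-a * (n : ℝ) ^ 2) := by
      refine (summable_pow_mul_jacobiTheta₂_term_bound 0 (div_pos ha Real.pi_pos) 0).congr
        fun n => ?_
      rw [pow_zero, one_mul]
      congr 1
      field_simp
      ring
    rw [← (Fin.consEquiv fun _ : Fin (d + 1) => ℤ).summable_iff]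
    refine (h1.mul_of_nonneg ih (fun _ => (Real.exp_pos _).le)
      fun _ => (Real.exp_pos _).le).congr fun p => ?_
    simp [Fin.sum_univ_succ, ← Real.exp_add, mul_add, Fin.consEquiv]

variable {d : ℕ} {A B : Matrix (Fin d) (Fin d) ℝ}

lemma dotProduct_mulVec_mulVec_of_transpose_mul_eq_one (hAB : Aᵀ * B = 1) (v w : Fin d → ℝ) :
    A *ᵥ v ⬝ᵥ B *ᵥ w = v ⬝ᵥ w := by
  rw [← vecMul_transpose, ← dotProduct_mulVec, mulVec_mulVec, hAB, one_mulVec]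

lemma exists_sum_sq_le_mul_sum_mulVec_sq (hAB : Aᵀ * B = 1) :
    ∃ K : ℝ, 0 < K ∧ ∀ v : Fin d → ℝ, ∑ i, v i ^ 2 ≤ K * ∑ i, (B *ᵥ v) i ^ 2 := by
  refine ⟨∑ j, ∑ i, A i j ^ 2 + 1, by positivity, fun v => ?_⟩
  have hv : v = Aᵀ *ᵥ (B *ᵥ v) := by rw [mulVec_mulVec, hAB, one_mulVec]
  set w := B *ᵥ v
  have hw : 0 ≤ ∑ i, w i ^ 2 := by positivity
  calc ∑ j, v j ^ 2 = ∑ j, (∑ i, A i j * w i) ^ 2 := by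
        conv_lhs => rw [hv]
        rfl
    _ ≤ ∑ j, (∑ i, A i j ^ 2) * ∑ i, w i ^ 2 :=
        Finset.sum_le_sum fun j _ => Finset.sum_mul_sq_le_sq_mul_sq _ _ _
    _ ≤ (∑ j, ∑ i, A i j ^ 2 + 1) * ∑ i, w i ^ 2 := by
        rw [← Finset.sum_mul]
        nlinarith

lemma measurePreserving_mulVec_s12 (hB : |B.det| = 1) :
    MeasurePreserving (fun v : Fin d → ℝ => B *ᵥ v) := by
  have hB0 : B.det ≠ 0 := fun h => by simp [h] at hB
  refine ⟨by fun_prop, ?_⟩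
  have := Real.map_matrix_volume_pi_eq_smul_volume_pi hB0
  rwa [abs_inv, hB, inv_one, ENNReal.ofReal_one, one_smul] at this

/-- The Jacobi transformation formula for the translated theta function of a lattice. -/
theorem exists_hasSum_theta (hAB : Aᵀ * B = 1) (hB : |B.det| = 1) {α : ℝ} (hα : 0 < α) :
    ∃ C : ℝ, 0 < C ∧ ∀ x : Fin d → ℝ,
      HasSum (fun m : Fin d → ℤ => C * (Real.exp (-(π / α) * ∑ i, (A *ᵥ fun j => (m j : ℝ)) i ^ 2) *
        Real.cos (2 * π * ∑ i, (m i : ℝ) * x i)))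
        (∑' n : Fin d → ℤ,
          Real.exp (-π * α * ∑ i, ((B *ᵥ fun j => (n j : ℝ)) i + (B *ᵥ x) i) ^ 2)) := by
  have hπα : 0 < π * α := mul_pos Real.pi_pos hα
  have hre : 0 < ((π * α : ℝ) : ℂ).re := by simpa using hπα
  set g : (Fin d → ℝ) → ℂ := fun y => (Real.exp (-(π * α) * ∑ i, (B *ᵥ y) i ^ 2) : ℝ) with hg
  have hgc : Continuous g := by fun_prop
  have hmp := measurePreserving_mulVec_s12 hB
  let h (c v : Fin d → ℝ) : ℂ := Complex.exp (-((π * α : ℝ) : ℂ) * ∑ i, (v i : ℂ) ^ 2 +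
    ∑ i, (-2 * π * Complex.I * c i) * (v i : ℂ))
  have hhi (c : Fin d → ℝ) : Integrable (h c) :=
    GaussianFourier.integrable_cexp_neg_mul_sum_add hre _
  have hhint (c : Fin d → ℝ) : ∫ v, h c v = ((α⁻¹ ^ ((d : ℝ) / 2) *
      Real.exp (-(π / α) * ∑ i, c i ^ 2) : ℝ) : ℂ) := by
    have := GaussianFourier.integral_cexp_neg_mul_sum_add hre
      (fun i => -2 * π * Complex.I * c i)
    simp only [h]
    rw [this, Complex.ofReal_mul (α⁻¹ ^ _), Complex.ofReal_cpow (inv_nonneg.2 hα.le), Fintype.card_fin,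
      Complex.ofReal_exp]
    have hα' : (α : ℂ) ≠ 0 := by exact_mod_cast hα.ne'
    have hπ' : (π : ℂ) ≠ 0 := by exact_mod_cast Real.pi_ne_zero
    congr 2
    · push_cast
      field_simp
    · push_cast
      rfl
    · push_cast
      simp only [mul_pow, Complex.I_sq, ← Finset.mul_sum]
      field_simp
      ring
  have hgh (m : Fin d → ℤ) (y : Fin d → ℝ) :
      (Real.fourierChar (-∑ i, (m i : ℝ) * y i) : ℂ) * g y =
        h (A *ᵥ fun j => (m j : ℝ)) (B *ᵥ y) := by
    have := dotProduct_mulVec_mulVec_of_transpose_mul_eq_one hAB (fun j => (m j : ℝ)) y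
    simp only [dotProduct] at this
    rw [← this, Real.fourierChar_apply]
    simp only [hg, h, Complex.ofReal_exp, ← Complex.exp_add]
    congr 1
    push_cast
    simp only [mul_assoc, ← Finset.mul_sum]
    ring
  have hgint (m : Fin d → ℤ) : ∫ y, (Real.fourierChar (-∑ i, (m i : ℝ) * y i) : ℂ) * g y =
      ((α⁻¹ ^ ((d : ℝ) / 2) *
        Real.exp (-(π / α) * ∑ i, (A *ᵥ fun j => (m j : ℝ)) i ^ 2) : ℝ) : ℂ) := by
    simp only [hgh]
    have hmap := integral_map hmp.aemeasurable (f := h (A *ᵥ fun j => (m j : ℝ)))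
      (by rw [hmp.map_eq]; exact (hhi _).aestronglyMeasurable)
    rw [hmp.map_eq] at hmap
    rw [← hhint, hmap]
  have hgi : Integrable g := by
    refine (hmp.integrable_comp_of_integrable
      (hhi (A *ᵥ fun j => ((0 : Fin d → ℤ) j : ℝ)))).congr (.of_forall fun y => ?_)
    simpa using (hgh 0 y).symm
  refine ⟨α⁻¹ ^ ((d : ℝ) / 2), by positivity, fun x => ?_⟩
  have hAB' : Bᵀ * A = 1 := by
    rw [← transpose_transpose A, ← transpose_mul, hAB, transpose_one]
  obtain ⟨K, hK, hKA⟩ := exists_sum_sq_le_mul_sum_mulVec_sq hAB'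
  obtain ⟨K', hK', hKB⟩ := exists_sum_sq_le_mul_sum_mulVec_sq hAB
  have key := hasSum_fourier_tsum_translates hgc hgi (fun R => ?_) ?_ x
  · have := Complex.hasSum_re key
    simp only [hgint, Complex.re_ofReal_mul] at this
    convert! this using 1
    · funext m
      rw [Real.fourierChar_apply, Complex.exp_ofReal_mul_I_re, mul_assoc (α⁻¹ ^ _)]
    · simp only [hg, ← Complex.ofReal_tsum, Complex.ofReal_re]
      refine tsum_congr fun n => ?_
      rw [add_comm x, mulVec_add, neg_mul]
      rfl
  · refine ⟨fun n => Real.exp (π * α / K' * (d * R ^ 2)) *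
      Real.exp (-(π * α / (2 * K')) * ∑ i, (n i : ℝ) ^ 2),
      (summable_exp_neg_mul_sum_int_sq d (by positivity)).mul_left _, fun n y hy => ?_⟩
    simp only [hg, Complex.norm_real, Real.norm_eq_abs, Real.abs_exp, ← Real.exp_add]
    refine Real.exp_le_exp.2 ?_
    have h1 : ∑ i, (n i : ℝ) ^ 2 ≤
        2 * ∑ i, (y + fun i => (n i : ℝ)) i ^ 2 + 2 * (d * R ^ 2) := by
      have h2 : (d * R ^ 2 : ℝ) = ∑ i : Fin d, R ^ 2 := by simp
      rw [h2, Finset.mul_sum, Finset.mul_sum, ← Finset.sum_add_distrib]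
      refine Finset.sum_le_sum fun i _ => ?_
      have h3 : y i ^ 2 ≤ R ^ 2 := sq_le_sq' (by
        have := (abs_le.1 ((norm_le_pi_norm y i).trans hy)).1; linarith)
        (abs_le.1 ((norm_le_pi_norm y i).trans hy)).2
      simp only [Pi.add_apply]
      nlinarith [sq_nonneg (2 * y i + n i)]
    have h4 := hKB (y + fun i => (n i : ℝ))
    set P := ∑ i, (B *ᵥ (y + fun i => (n i : ℝ))) i ^ 2
    have h5 : ∑ i, (n i : ℝ) ^ 2 ≤ 2 * (K' * P) + 2 * (d * R ^ 2) := by linarith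
    have h6 := mul_le_mul_of_nonneg_left h5 (show 0 ≤ π * α / (2 * K') by positivity)
    have h7 : π * α / (2 * K') * (2 * (K' * P) + 2 * (d * R ^ 2)) =
        π * α * P + π * α / K' * (d * R ^ 2) := by
      field_simp
    linarith
  · simp only [hgint]
    refine Complex.ofRealCLM.summable (Summable.mul_left _ ?_)
    refine .of_nonneg_of_le (fun _ => (Real.exp_pos _).le) (fun m => Real.exp_le_exp.2 ?_)
      (summable_exp_neg_mul_sum_int_sq d (a := π / α / K) (by positivity))
    have := mul_le_mul_of_nonneg_left (hKA fun j => (m j : ℝ))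
      (show 0 ≤ π / α / K by positivity)
    rw [← mul_assoc, div_mul_cancel₀ _ hK.ne'] at this
    linarith

end Theta

section Energy

open Matrix Set

variable {d : ℕ} {A B : Matrix (Fin d) (Fin d) ℝ}

lemma measure_singleton_zero_of_summable (hd : 1 ≤ d) {μ : Measure ℝ} {q : (Fin d → ℤ) → ℝ}
    (hint : ∀ m : {m : Fin d → ℤ // m ≠ 0},
      IntegrableOn (fun t : ℝ => Real.exp (-q m.1 * t)) (Ici 0) μ)
    (hsum : Summable fun m : {m : Fin d → ℤ // m ≠ 0} =>
      ∫ t in Ici 0, Real.exp (-q m.1 * t) ∂μ) : μ {0} = 0 := by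
  have : Nonempty (Fin d) := ⟨⟨0, hd⟩⟩
  have hinf : Infinite {m : Fin d → ℤ // m ≠ 0} :=
    (Set.finite_singleton (0 : Fin d → ℤ)).infinite_compl.to_subtype
  obtain ⟨m₀⟩ : Nonempty {m : Fin d → ℤ // m ≠ 0} := inferInstance
  have h0 : ({0} : Set ℝ) ⊆ Ici 0 := by simp
  have hfin : μ {0} < ⊤ := by
    have h1 := (hint m₀).mono_set h0
    rw [integrableOn_singleton_iff] at h1
    simpa using h1
  have hle (m : {m : Fin d → ℤ // m ≠ 0}) :
      μ.real {0} ≤ ∫ t in Ici 0, Real.exp (-q m.1 * t) ∂μ := by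
    have h1 := setIntegral_mono_set (hint m) (.of_forall fun t => (Real.exp_pos _).le)
      h0.eventuallyLE
    rw [Measure.restrict_singleton] at h1
    simpa [Measure.real] using h1
  have h2 : Summable fun _ : {m : Fin d → ℤ // m ≠ 0} => μ.real {0} :=
    .of_nonneg_of_le (fun _ => measureReal_nonneg) hle hsum
  rw [summable_const_iff, measureReal_eq_zero_iff hfin.ne] at h2
  exact h2

/-- Minimality of the translated theta function at all scales passes to Gaussian mixtures on the
dual side. -/
theorem tsum_cos_mul_le_of_theta_le (hd : 1 ≤ d) (hAB : Aᵀ * B = 1) (hB : |B.det| = 1)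
    {μ : Measure ℝ} {f : (Fin d → ℝ) → ℝ}
    (hμf : ∀ x : Fin d → ℝ, x ≠ 0 →
      IntegrableOn (fun t : ℝ => Real.exp (-(∑ i, x i ^ 2) * t)) (Ici 0) μ)
    (hf : ∀ x : Fin d → ℝ, x ≠ 0 →
      f x = ∫ t in Ici 0, Real.exp (-(∑ i, x i ^ 2) * t) ∂μ)
    (hsum : Summable fun m : {m : Fin d → ℤ // m ≠ 0} => f (A *ᵥ fun j => (m.1 j : ℝ)))
    {x₀ x : Fin d → ℝ}
    (hmin : ∀ α : ℝ, 0 < α →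
      (∑' n : Fin d → ℤ,
        Real.exp (-π * α * ∑ i, ((B *ᵥ fun j => (n j : ℝ)) i + (B *ᵥ x₀) i) ^ 2)) ≤
      ∑' n : Fin d → ℤ,
        Real.exp (-π * α * ∑ i, ((B *ᵥ fun j => (n j : ℝ)) i + (B *ᵥ x) i) ^ 2)) :
    (∑' m : {m : Fin d → ℤ // m ≠ 0}, Real.cos (2 * π * ∑ i, (m.1 i : ℝ) * x₀ i) *
      f (A *ᵥ fun j => (m.1 j : ℝ))) ≤
    ∑' m : {m : Fin d → ℤ // m ≠ 0}, Real.cos (2 * π * ∑ i, (m.1 i : ℝ) * x i) *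
      f (A *ᵥ fun j => (m.1 j : ℝ)) := by
  have hA0 (m : {m : Fin d → ℤ // m ≠ 0}) : (A *ᵥ fun j => (m.1 j : ℝ)) ≠ 0 := by
    intro h
    have hBA : Bᵀ * A = 1 := by
      rw [← transpose_transpose A, ← transpose_mul, hAB, transpose_one]
    have h1 := congrArg (fun v => Bᵀ *ᵥ v) h
    simp only [mulVec_mulVec, hBA, one_mulVec, mulVec_zero] at h1
    exact m.2 (funext fun j => by simpa using congrFun h1 j)
  set q : (Fin d → ℤ) → ℝ := fun m => ∑ i, (A *ᵥ fun j => (m j : ℝ)) i ^ 2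
  have hint (m : {m : Fin d → ℤ // m ≠ 0}) :
      IntegrableOn (fun t : ℝ => Real.exp (-q m.1 * t)) (Ici 0) μ := hμf _ (hA0 m)
  have hfq (m : {m : Fin d → ℤ // m ≠ 0}) :
      f (A *ᵥ fun j => (m.1 j : ℝ)) = ∫ t in Ici 0, Real.exp (-q m.1 * t) ∂μ := hf _ (hA0 m)
  simp only [hfq] at hsum ⊢
  have hμ0 := measure_singleton_zero_of_summable hd hint hsum
  set w : (Fin d → ℤ) → ℝ := fun m =>
    Real.cos (2 * π * ∑ i, (m i : ℝ) * x i) - Real.cos (2 * π * ∑ i, (m i : ℝ) * x₀ i) with hw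
  have hw2 (m : Fin d → ℤ) : |w m| ≤ 2 := by
    refine (abs_sub _ _).trans ?_
    linarith [Real.abs_cos_le_one (2 * π * ∑ i, (m i : ℝ) * x i),
      Real.abs_cos_le_one (2 * π * ∑ i, (m i : ℝ) * x₀ i)]
  have hcos (y : Fin d → ℝ) : Summable fun m : {m : Fin d → ℤ // m ≠ 0} =>
      Real.cos (2 * π * ∑ i, (m.1 i : ℝ) * y i) * ∫ t in Ici 0, Real.exp (-q m.1 * t) ∂μ :=
    hsum.norm.mul_left 1 |>.of_norm_bounded fun m => by
      rw [norm_mul]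
      gcongr
      exact Real.abs_cos_le_one _
  rw [← sub_nonneg, ← (hcos x).tsum_sub (hcos x₀)]
  have key := hasSum_integral_of_summable_integral_norm (μ := μ.restrict (Ici 0))
    (F := fun (m : {m : Fin d → ℤ // m ≠ 0}) t => w m.1 * Real.exp (-q m.1 * t))
    (fun m => (hint m).const_mul _) (by
      simp only [norm_mul, integral_const_mul, Real.norm_eq_abs, Real.abs_exp]
      refine .of_nonneg_of_le (fun m => by positivity) (fun m => ?_) (hsum.mul_left 2)
      gcongr
      exact hw2 _)
  simp only [integral_const_mul] at key
  simp only [← sub_mul]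
  change 0 ≤ ∑' m : {m : Fin d → ℤ // m ≠ 0}, w m.1 * ∫ t in Ici 0, Real.exp (-q m.1 * t) ∂μ
  rw [key.tsum_eq]
  refine integral_nonneg_of_ae ?_
  have hne : ∀ᵐ t ∂μ, t ≠ 0 := by
    rw [ae_iff]
    simpa using hμ0
  refine (ae_restrict_iff' measurableSet_Ici).2 (hne.mono fun t ht0 ht => ?_)
  have ht : 0 < t := lt_of_le_of_ne ht ht0.symm
  obtain ⟨C, hC, hθ⟩ := exists_hasSum_theta hAB hB (div_pos Real.pi_pos ht)
  have h1 := (hθ x).sub (hθ x₀)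
  have h2 := sub_nonneg.2 (hmin _ (div_pos Real.pi_pos ht))
  have h3 : HasSum (fun m : Fin d → ℤ => C * (w m * Real.exp (-q m * t))) _ :=
    h1.congr_fun fun m => by
      simp only [hw, q, div_div_cancel₀ Real.pi_ne_zero]
      rw [neg_mul, neg_mul, mul_comm t]
      ring
  rw [← hasSum_subtype_iff_of_support_subset (s := {m : Fin d → ℤ | m ≠ 0})] at h3
  · have h4 := h3.tsum_eq.symm ▸ h2
    have h5 : (∑' m : {m : Fin d → ℤ // m ≠ 0}, C * (w m.1 * Real.exp (-q m.1 * t))) =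
      C * ∑' m : {m : Fin d → ℤ // m ≠ 0}, w m.1 * Real.exp (-q m.1 * t) := tsum_mul_left
    exact nonneg_of_mul_nonneg_right (h5 ▸ h4) hC
  · intro m hm h0
    exact hm (by simp [h0, hw])

lemma sum_Ico_fourierChar {L : ℕ} (hL : 1 ≤ L) (u : ℤ) :
    ∑ y ∈ Finset.Ico (0 : ℤ) L, (Real.fourierChar ((y : ℝ) * (u / L)) : ℂ) =
      if (L : ℤ) ∣ u then (L : ℂ) else 0 := by
  have hL0 : (L : ℂ) ≠ 0 := by exact_mod_cast (by lia : L ≠ 0)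
  have hL0' : (L : ℝ) ≠ 0 := by exact_mod_cast (by lia : L ≠ 0)
  obtain ⟨ζ, hζ⟩ : ∃ ζ : ℂ, ζ = Real.fourierChar ((u : ℝ) / L) := ⟨_, rfl⟩
  have hζn (n : ℕ) : (Real.fourierChar ((n : ℝ) * (u / L)) : ℂ) = ζ ^ n := by
    rw [hζ, ← nsmul_eq_mul, AddChar.map_nsmul_eq_pow, Circle.coe_pow]
  have h1 : ∑ y ∈ Finset.Ico (0 : ℤ) L, (Real.fourierChar ((y : ℝ) * (u / L)) : ℂ) =
      ∑ n ∈ Finset.range L, ζ ^ n := by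
    refine Finset.sum_nbij' Int.toNat (fun n : ℕ => (n : ℤ)) ?_ ?_ ?_ ?_ ?_
    · intro a ha; simp only [Finset.mem_Ico, Finset.mem_range] at *; lia
    · intro a ha; simp only [Finset.mem_Ico, Finset.mem_range] at *; lia
    · intro a ha; simp only [Finset.mem_Ico] at *; lia
    · intro a ha; simp
    · intro a ha
      simp only [Finset.mem_Ico] at ha
      obtain ⟨n, rfl⟩ := Int.eq_ofNat_of_zero_le ha.1
      simpa using hζn n
  have hζ1 : ζ = 1 ↔ (L : ℤ) ∣ u := by
    rw [hζ, Real.fourierChar_apply, Complex.exp_eq_one_iff]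
    have h2π : (2 * π * Complex.I : ℂ) ≠ 0 := Complex.two_pi_I_ne_zero
    refine exists_congr fun n => ?_
    push_cast
    constructor
    · intro h
      have h3 : (u : ℂ) / L = n := mul_left_cancel₀ h2π (by linear_combination h)
      rw [div_eq_iff hL0] at h3
      have : u = n * L := by exact_mod_cast h3
      rw [this, mul_comm]
    · rintro rfl
      push_cast
      field_simp
  rw [h1]
  split_ifs with h
  · simp [hζ1.2 h]
  · have hne : ζ - 1 ≠ 0 := sub_ne_zero.2 (mt hζ1.1 h)
    have hζL : ζ ^ L = 1 := by
      rw [← hζn, mul_div_cancel₀ _ hL0', Real.fourierChar_apply, Complex.exp_eq_one_iff]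
      exact ⟨u, by push_cast; ring⟩
    have h3 := mul_geom_sum ζ L
    rw [hζL, sub_self] at h3
    exact (mul_eq_zero.1 h3).resolve_left hne

lemma sum_piFinset_fourierChar {L : ℕ} (hL : 1 ≤ L) (u : Fin d → ℤ) :
    ∑ y ∈ Fintype.piFinset (fun _ : Fin d => Finset.Ico (0 : ℤ) L),
      (Real.fourierChar (∑ i, (y i : ℝ) * (u i / L)) : ℂ) =
      if ∀ i, (L : ℤ) ∣ u i then (L : ℂ) ^ d else 0 := by
  have h1 (y : Fin d → ℤ) : (Real.fourierChar (∑ i, (y i : ℝ) * (u i / L)) : ℂ) =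
      ∏ i, (Real.fourierChar ((y i : ℝ) * (u i / L)) : ℂ) := by
    simp only [Real.fourierChar_apply, ← Complex.exp_sum]
    push_cast
    simp only [Finset.mul_sum, Finset.sum_mul]
  simp only [h1]
  rw [← Finset.prod_univ_sum (fun _ : Fin d => Finset.Ico (0 : ℤ) L)
    fun i y => (Real.fourierChar ((y : ℝ) * (u i / L)) : ℂ)]
  simp only [sum_Ico_fourierChar hL]
  split_ifs with h
  · simp [h]
  · push Not at h
    obtain ⟨i, hi⟩ := h
    exact Finset.prod_eq_zero (Finset.mem_univ i) (if_neg hi)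

lemma periodic_eq_of_dvd {L : ℕ} {χ : (Fin d → ℤ) → ℝ}
    (hχ : ∀ (m : Fin d → ℤ) (i : Fin d), χ (m + Pi.single i (L : ℤ)) = χ m)
    {m m' : Fin d → ℤ} (h : ∀ i, (L : ℤ) ∣ m i - m' i) : χ m = χ m' := by
  let P : AddSubgroup (Fin d → ℤ) :=
    { carrier := {v | ∀ m, χ (m + v) = χ m}
      zero_mem' := fun m => by simp
      add_mem' := fun {a b} ha hb m => by rw [← add_assoc, hb, ha]
      neg_mem' := fun {a} ha m => by rw [← ha, neg_add_cancel_right] }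
  choose k hk using h
  have hP : ∑ i, k i • (Pi.single i (L : ℤ) : Fin d → ℤ) ∈ P :=
    sum_mem fun i _ => P.zsmul_mem (show Pi.single i (L : ℤ) ∈ P from fun m => hχ m i) _
  rw [← hP m']
  congr 1
  funext j
  have := hk j
  simp only [Pi.add_apply, Finset.sum_apply, Pi.smul_apply, Pi.single_apply, smul_eq_mul, mul_ite,
    mul_zero, Finset.sum_ite_eq, Finset.mem_univ, if_true]
  linarith

lemma exists_mem_piFinset_dvd_sub {L : ℕ} (hL : 1 ≤ L) (m : Fin d → ℤ) :
    ∃ r ∈ Fintype.piFinset (fun _ : Fin d => Finset.Ico (0 : ℤ) L), ∀ i, (L : ℤ) ∣ m i - r i :=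
  ⟨fun i => m i % L, by
    simp only [Fintype.mem_piFinset, Finset.mem_Ico]
    exact fun i => ⟨Int.emod_nonneg _ (by lia), Int.emod_lt_of_pos _ (by lia)⟩,
    fun i => Int.dvd_self_sub_emod⟩

lemma sum_mul_ite_dvd_of_periodic {L : ℕ} (hL : 1 ≤ L) {χ : (Fin d → ℤ) → ℝ}
    (hχ : ∀ (m : Fin d → ℤ) (i : Fin d), χ (m + Pi.single i (L : ℤ)) = χ m) (m : Fin d → ℤ) :
    ∑ r ∈ Fintype.piFinset (fun _ : Fin d => Finset.Ico (0 : ℤ) L),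
      (if ∀ i, (L : ℤ) ∣ m i - r i then χ r else 0) = χ m := by
  obtain ⟨r, hr, hmr⟩ := exists_mem_piFinset_dvd_sub hL m
  rw [Finset.sum_eq_single_of_mem r hr, if_pos hmr, periodic_eq_of_dvd hχ hmr]
  intro s hs hsr
  refine if_neg fun h => hsr (funext fun i => ?_)
  simp only [Fintype.mem_piFinset, Finset.mem_Ico] at hr hs
  have h1 := dvd_sub (h i) (hmr i)
  have h2 : m i - s i - (m i - r i) = r i - s i := by ring
  rw [h2] at h1
  have := Int.eq_zero_of_abs_lt_dvd h1 (by rw [abs_lt]; constructor <;> linarith [hr i, hs i])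
  linarith

/-- The autocorrelation of a periodic function is a nonnegative combination of characters. -/
theorem exists_autocorrelation_eq {L : ℕ} (hL : 1 ≤ L) {χ : (Fin d → ℤ) → ℝ}
    (hχ : ∀ (m : Fin d → ℤ) (i : Fin d), χ (m + Pi.single i (L : ℤ)) = χ m) :
    ∃ ξ : (Fin d → ℤ) → ℝ, (∀ k, 0 ≤ ξ k) ∧ ∀ m : Fin d → ℤ,
      ((L : ℝ) ^ d)⁻¹ * ∑ y ∈ Fintype.piFinset (fun _ : Fin d => Finset.Ico (0 : ℤ) L),
        χ y * χ (y + m) =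
      ∑ k ∈ Fintype.piFinset (fun _ : Fin d => Finset.Ico (0 : ℤ) L),
        ξ k * Real.cos (2 * π * ∑ i, (m i : ℝ) * (k i / L)) := by
  set K := Fintype.piFinset (fun _ : Fin d => Finset.Ico (0 : ℤ) L)
  have hL0 : (L : ℝ) ≠ 0 := by exact_mod_cast (by lia : L ≠ 0)
  let T : (Fin d → ℤ) → ℂ := fun k =>
    ∑ y ∈ K, (χ y : ℂ) * Real.fourierChar (∑ i, (k i : ℝ) * (y i / L))
  refine ⟨fun k => ((L : ℝ) ^ d)⁻¹ ^ 2 * Complex.normSq (T k), fun k => mul_nonneg (by positivity)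
    (Complex.normSq_nonneg _), fun m => ?_⟩
  have hconj (k : Fin d → ℤ) : (starRingEnd ℂ) (T k) =
      ∑ y ∈ K, (χ y : ℂ) * Real.fourierChar (-∑ i, (k i : ℝ) * (y i / L)) := by
    simp only [T, map_sum, map_mul, Complex.conj_ofReal, AddChar.map_neg_eq_inv,
      Circle.coe_inv_eq_conj]
  have hterm (k : Fin d → ℤ) : (Complex.normSq (T k) : ℂ) *
      Real.fourierChar (∑ i, (m i : ℝ) * (k i / L)) =
      ∑ y ∈ K, ∑ r ∈ K, (χ y : ℂ) * χ r *
        Real.fourierChar (∑ i, (k i : ℝ) * (((y + m - r) i : ℤ) / L)) := by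
    rw [← Complex.mul_conj, hconj, mul_comm (T k), Finset.sum_mul_sum, Finset.sum_comm,
      Finset.sum_mul]
    refine Finset.sum_congr rfl fun y _ => ?_
    rw [Finset.sum_mul]
    refine Finset.sum_congr rfl fun r _ => ?_
    have h1 : ∑ i, (k i : ℝ) * (((y + m - r) i : ℤ) / L) =
        -∑ i, (k i : ℝ) * (r i / L) + ∑ i, (k i : ℝ) * (y i / L) +
          ∑ i, (m i : ℝ) * (k i / L) := by
      rw [← Finset.sum_neg_distrib, ← Finset.sum_add_distrib, ← Finset.sum_add_distrib]
      refine Finset.sum_congr rfl fun i _ => ?_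
      simp only [Pi.sub_apply, Pi.add_apply]
      push_cast
      ring
    rw [h1, AddChar.map_add_eq_mul, AddChar.map_add_eq_mul, Circle.coe_mul, Circle.coe_mul]
    ring
  have hsum : ∑ k ∈ K, (Complex.normSq (T k) : ℂ) *
      Real.fourierChar (∑ i, (m i : ℝ) * (k i / L)) =
      ((L : ℝ) ^ d * ∑ y ∈ K, χ y * χ (y + m) : ℝ) := by
    simp only [hterm]
    rw [Finset.sum_comm]
    push_cast
    rw [Finset.mul_sum]
    refine Finset.sum_congr rfl fun y _ => ?_
    rw [Finset.sum_comm]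
    simp only [← Finset.mul_sum, K, sum_piFinset_fourierChar hL]
    rw [← sum_mul_ite_dvd_of_periodic hL hχ (y + m)]
    push_cast
    simp only [Finset.mul_sum, Pi.sub_apply]
    refine Finset.sum_congr rfl fun r _ => ?_
    split_ifs
    · ring
    · simp
  have hre := congrArg Complex.re hsum
  simp only [Complex.re_sum, Complex.re_ofReal_mul, Real.fourierChar_apply,
    Complex.exp_ofReal_mul_I_re, Complex.ofReal_re] at hre
  simp only [mul_assoc, ← Finset.mul_sum] at hre ⊢
  rw [hre]
  field_simp

lemma exists_abs_le_of_periodic {L : ℕ} (hL : 1 ≤ L) {χ : (Fin d → ℤ) → ℝ}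
    (hχ : ∀ (m : Fin d → ℤ) (i : Fin d), χ (m + Pi.single i (L : ℤ)) = χ m) :
    ∃ b : ℝ, ∀ m, |χ m| ≤ b := by
  refine ⟨∑ r ∈ Fintype.piFinset (fun _ : Fin d => Finset.Ico (0 : ℤ) L), |χ r|, fun m => ?_⟩
  obtain ⟨r, hr, hmr⟩ := exists_mem_piFinset_dvd_sub hL m
  rw [periodic_eq_of_dvd hχ hmr]
  exact Finset.single_le_sum (f := fun r => |χ r|) (fun _ _ => abs_nonneg _) hr

lemma energy_eq_tsum_autocorrelation {L : ℕ} (hL : 1 ≤ L) {χ : (Fin d → ℤ) → ℝ}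
    (hχ : ∀ (m : Fin d → ℤ) (i : Fin d), χ (m + Pi.single i (L : ℤ)) = χ m)
    {g : {m : Fin d → ℤ // m ≠ 0} → ℝ} (hg : Summable g) :
    (2 * (L : ℝ) ^ d)⁻¹ * ∑ y ∈ Fintype.piFinset (fun _ : Fin d => Finset.Ico (0 : ℤ) L),
      ∑' m : {m : Fin d → ℤ // m ≠ 0}, χ y * χ (y + m.1) * g m =
    2⁻¹ * ∑' m : {m : Fin d → ℤ // m ≠ 0}, ((L : ℝ) ^ d)⁻¹ *
      (∑ y ∈ Fintype.piFinset (fun _ : Fin d => Finset.Ico (0 : ℤ) L), χ y * χ (y + m.1)) *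
        g m := by
  obtain ⟨b, hb⟩ := exists_abs_le_of_periodic hL hχ
  have hs (y : Fin d → ℤ) : Summable fun m : {m : Fin d → ℤ // m ≠ 0} =>
      χ y * χ (y + m.1) * g m := by
    refine (hg.norm.mul_left (b * b)).of_norm_bounded fun m => ?_
    rw [norm_mul, norm_mul]
    have := (abs_nonneg _).trans (hb 0)
    gcongr
    · exact hb _
    · exact hb _
  rw [← Summable.tsum_finsetSum fun y _ => hs y, mul_inv, mul_assoc, ← tsum_mul_left]
  simp only [Finset.sum_mul, mul_assoc]

/-- The energy of a normalized periodic charge is at least the minimum of the energies of the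
characters. -/
theorem le_energy_of_forall_le {L : ℕ} (hL : 1 ≤ L) {χ : (Fin d → ℤ) → ℝ}
    (hχ : ∀ (m : Fin d → ℤ) (i : Fin d), χ (m + Pi.single i (L : ℤ)) = χ m)
    (hnorm : ((L : ℝ) ^ d)⁻¹ *
      (∑ y ∈ Fintype.piFinset (fun _ : Fin d => Finset.Ico (0 : ℤ) L), χ y ^ 2) = 1)
    {g : {m : Fin d → ℤ // m ≠ 0} → ℝ} (hg : Summable g) {S : ℝ}
    (hS : ∀ x : Fin d → ℝ, S ≤ ∑' m : {m : Fin d → ℤ // m ≠ 0},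
      Real.cos (2 * π * ∑ i, (m.1 i : ℝ) * x i) * g m) :
    2⁻¹ * S ≤ (2 * (L : ℝ) ^ d)⁻¹ *
      ∑ y ∈ Fintype.piFinset (fun _ : Fin d => Finset.Ico (0 : ℤ) L),
        ∑' m : {m : Fin d → ℤ // m ≠ 0}, χ y * χ (y + m.1) * g m := by
  obtain ⟨ξ, hξ, hcor⟩ := exists_autocorrelation_eq hL hχ
  rw [energy_eq_tsum_autocorrelation hL hχ hg]
  have hξ1 : ∑ k ∈ Fintype.piFinset (fun _ : Fin d => Finset.Ico (0 : ℤ) L), ξ k = 1 := by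
    rw [← hnorm]
    have h0 := hcor 0
    simp only [add_zero, ← sq, Pi.zero_apply, Int.cast_zero, zero_mul, Finset.sum_const_zero,
      mul_zero, Real.cos_zero, mul_one] at h0
    exact h0.symm
  have hcos (x : Fin d → ℝ) : Summable fun m : {m : Fin d → ℤ // m ≠ 0} =>
      Real.cos (2 * π * ∑ i, (m.1 i : ℝ) * x i) * g m :=
    hg.norm.mul_left 1 |>.of_norm_bounded fun m => by
      rw [norm_mul]
      gcongr
      exact Real.abs_cos_le_one _
  have htsum : ∑' m : {m : Fin d → ℤ // m ≠ 0}, ((L : ℝ) ^ d)⁻¹ *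
      (∑ y ∈ Fintype.piFinset (fun _ : Fin d => Finset.Ico (0 : ℤ) L), χ y * χ (y + m.1)) * g m =
      ∑ k ∈ Fintype.piFinset (fun _ : Fin d => Finset.Ico (0 : ℤ) L), ξ k *
        ∑' m : {m : Fin d → ℤ // m ≠ 0},
          Real.cos (2 * π * ∑ i, (m.1 i : ℝ) * ((k i : ℝ) / L)) * g m := by
    simp only [← tsum_mul_left]
    rw [← Summable.tsum_finsetSum fun k _ => (hcos fun i => (k i : ℝ) / L).mul_left (ξ k)]
    refine tsum_congr fun m => ?_
    rw [hcor, Finset.sum_mul]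
    exact Finset.sum_congr rfl fun k _ => mul_assoc _ _ _
  rw [htsum]
  refine mul_le_mul_of_nonneg_left ?_ (by norm_num)
  rw [← one_mul S, ← hξ1, Finset.sum_mul]
  exact Finset.sum_le_sum fun k _ => mul_le_mul_of_nonneg_left (hS _) (hξ k)

/-- A suitably normalized periodic cosine has autocorrelation the cosine itself. -/
theorem exists_cos_autocorrelation_eq {N : ℕ} (hN : 1 ≤ N) (k : Fin d → ℤ) :
    ∃ c : ℝ, 0 < c ∧ ∀ m : Fin d → ℤ,
      ((N : ℝ) ^ d)⁻¹ * ∑ y ∈ Fintype.piFinset (fun _ : Fin d => Finset.Ico (0 : ℤ) N),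
        (c * Real.cos (2 * π * ∑ i, (y i : ℝ) * (k i / N))) *
          (c * Real.cos (2 * π * ∑ i, ((y + m) i : ℤ) * ((k i : ℝ) / N))) =
      Real.cos (2 * π * ∑ i, (m i : ℝ) * (k i / N)) := by
  have hN0 : (N : ℝ) ≠ 0 := by exact_mod_cast (by lia : N ≠ 0)
  set K := Fintype.piFinset (fun _ : Fin d => Finset.Ico (0 : ℤ) N)
  have hcard : ∑ _y ∈ K, (1 : ℝ) = (N : ℝ) ^ d := by simp [K]
  set δ : ℝ := if ∀ i, (N : ℤ) ∣ 2 * k i then 1 else 0 with hδ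
  have hsum (m : Fin d → ℤ) : ∑ y ∈ K, Real.cos (2 * π * ∑ i, (y i : ℝ) * ((2 * k i : ℤ) / N) +
      2 * π * ∑ i, (m i : ℝ) * (k i / N)) =
      δ * (N : ℝ) ^ d * Real.cos (2 * π * ∑ i, (m i : ℝ) * (k i / N)) := by
    have h1 := congrArg (fun z : ℂ => (z * Real.fourierChar (∑ i, (m i : ℝ) * (k i / N))).re)
      (sum_piFinset_fourierChar hN fun i => 2 * k i)
    have h2 : (if ∀ i, (N : ℤ) ∣ 2 * k i then (N : ℂ) ^ d else 0) = (δ * (N : ℝ) ^ d : ℝ) := by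
      rw [hδ]
      split_ifs <;> simp
    simp only [h2, Complex.re_ofReal_mul, Finset.sum_mul, Complex.re_sum, ← Circle.coe_mul,
      ← AddChar.map_add_eq_mul] at h1
    simp only [Real.fourierChar_apply, Complex.exp_ofReal_mul_I_re, mul_add] at h1
    exact h1
  obtain ⟨c, hc, hcδ⟩ : ∃ c : ℝ, 0 < c ∧ c ^ 2 * (1 + δ) = 2 := by
    by_cases h : ∀ i, (N : ℤ) ∣ 2 * k i
    · exact ⟨1, one_pos, by rw [hδ, if_pos h]; norm_num⟩
    · exact ⟨√2, by positivity, by rw [hδ, if_neg h]; norm_num⟩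
  refine ⟨c, hc, fun m => ?_⟩
  have hprod (y : Fin d → ℤ) : (c * Real.cos (2 * π * ∑ i, (y i : ℝ) * (k i / N))) *
      (c * Real.cos (2 * π * ∑ i, ((y + m) i : ℤ) * ((k i : ℝ) / N))) =
      c ^ 2 / 2 * (Real.cos (2 * π * ∑ i, (m i : ℝ) * (k i / N)) * 1 +
        Real.cos (2 * π * ∑ i, (y i : ℝ) * ((2 * k i : ℤ) / N) +
          2 * π * ∑ i, (m i : ℝ) * (k i / N))) := by
    have h1 : ∑ i, (y i : ℝ) * ((2 * k i : ℤ) / N) = 2 * ∑ i, (y i : ℝ) * (k i / N) := by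
      rw [Finset.mul_sum]
      exact Finset.sum_congr rfl fun i _ => by push_cast; ring
    have h2 : ∑ i, ((y + m) i : ℤ) * ((k i : ℝ) / N) =
        ∑ i, (y i : ℝ) * (k i / N) + ∑ i, (m i : ℝ) * (k i / N) := by
      rw [← Finset.sum_add_distrib]
      exact Finset.sum_congr rfl fun i _ => by simp [add_mul]
    rw [h1, h2]
    set a := ∑ i, (y i : ℝ) * (k i / N)
    set b := ∑ i, (m i : ℝ) * (k i / N)
    have h3 := Real.cos_add_cos (2 * π * (2 * a) + 2 * π * b) (2 * π * b)
    rw [show (2 * π * (2 * a) + 2 * π * b + 2 * π * b) / 2 = 2 * π * (a + b) by ring,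
      show (2 * π * (2 * a) + 2 * π * b - 2 * π * b) / 2 = 2 * π * a by ring] at h3
    linear_combination (-c ^ 2 / 2) * h3
  simp only [hprod]
  rw [← Finset.mul_sum, Finset.sum_add_distrib, ← Finset.mul_sum, hcard, hsum]
  generalize Real.cos (2 * π * ∑ i, (m i : ℝ) * (k i / N)) = b
  field_simp
  linear_combination b * hcδ

end Energy

/-- If `z₀` minimizes the translated theta function of the dual lattice `X* = Bℤ^d` for
every `α > 0`, and `Nz₀ ∈ Bℤ^d` for some `N ≥ 2`, then for `f ∈ 𝓕` summable on
`X∖{0}`, the configuration `φ*(m) = c·cos(2π(Am)·z₀)` (with `c` the normalizing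
constant) minimizes the energy per particle among all periodic normalized charge
configurations. -/
theorem optimal_charge_cosine_summable (d N : ℕ) (hd : 1 ≤ d) (hN : 2 ≤ N)
    (A : Matrix (Fin d) (Fin d) ℝ) (hA : IsUnit A.det) (hdet : |A.det| = 1)
    (B : Matrix (Fin d) (Fin d) ℝ) (hB : B = A⁻¹.transpose)
    (μ : Measure ℝ) (f : (Fin d → ℝ) → ℝ)
    (hμf : ∀ x : Fin d → ℝ, x ≠ 0 →
      IntegrableOn (fun t : ℝ => Real.exp (-(∑ i, x i ^ 2) * t)) (Set.Ici 0) μ)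
    (hf : ∀ x : Fin d → ℝ, x ≠ 0 →
      f x = ∫ t in Set.Ici 0, Real.exp (-(∑ i, x i ^ 2) * t) ∂μ)
    (hsum : Summable fun m : {m : Fin d → ℤ // m ≠ 0} => f (A.mulVec fun j => (m.1 j : ℝ)))
    (z₀ : Fin d → ℝ)
    (hz₀ : ∀ α : ℝ, 0 < α → ∀ z : Fin d → ℝ,
      (∑' n : Fin d → ℤ, Real.exp (-π * α * ∑ i, (B.mulVec (fun j => (n j : ℝ)) i + z₀ i) ^ 2)) ≤
        ∑' n : Fin d → ℤ, Real.exp (-π * α * ∑ i, (B.mulVec (fun j => (n j : ℝ)) i + z i) ^ 2))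
    (hz₀N : ∃ k : Fin d → ℤ, (N : ℝ) • z₀ = B.mulVec fun j => (k j : ℝ))
    (E : ℕ → ((Fin d → ℤ) → ℝ) → ℝ)
    (hE : ∀ (L : ℕ) (χ : (Fin d → ℤ) → ℝ),
      E L χ = (2 * (L : ℝ) ^ d)⁻¹ *
        ∑ y ∈ Fintype.piFinset (fun _ : Fin d => Finset.Ico (0 : ℤ) (L : ℤ)),
          ∑' m : {m : Fin d → ℤ // m ≠ 0},
            χ y * χ (y + m.1) * f (A.mulVec fun j => (m.1 j : ℝ))) :
    ∃ c : ℝ, 0 < c ∧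
      ∀ φstar : (Fin d → ℤ) → ℝ,
        (∀ m : Fin d → ℤ,
          φstar m = c * Real.cos (2 * π * ∑ i, A.mulVec (fun j => (m j : ℝ)) i * z₀ i)) →
        (∀ (m : Fin d → ℤ) (i : Fin d), φstar (m + Pi.single i (N : ℤ)) = φstar m) ∧
        ((N : ℝ) ^ d)⁻¹ *
          (∑ y ∈ Fintype.piFinset (fun _ : Fin d => Finset.Ico (0 : ℤ) (N : ℤ)), φstar y ^ 2) = 1 ∧
        (∀ (M : ℕ), 1 ≤ M → ∀ ψ : (Fin d → ℤ) → ℝ,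
          (∀ (m : Fin d → ℤ) (i : Fin d), ψ (m + Pi.single i (M : ℤ)) = ψ m) →
          ((M : ℝ) ^ d)⁻¹ *
            (∑ y ∈ Fintype.piFinset (fun _ : Fin d => Finset.Ico (0 : ℤ) (M : ℤ)), ψ y ^ 2) = 1 →
          E N φstar ≤ E M ψ) := by
  have hN0 : (N : ℝ) ≠ 0 := by positivity
  obtain ⟨k, hk⟩ := hz₀N
  have hAB : A.transpose * B = 1 := by
    rw [hB, ← Matrix.transpose_mul, Matrix.nonsing_inv_mul _ hA, Matrix.transpose_one]
  have hBdet : |B.det| = 1 := by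
    rw [hB, Matrix.det_transpose, Matrix.det_nonsing_inv, Ring.inverse_eq_inv', abs_inv, hdet,
      inv_one]
  have hz₀x : z₀ = B.mulVec fun i => (k i : ℝ) / N := by
    have h1 : (fun i => (k i : ℝ) / N) = (N : ℝ)⁻¹ • fun i => (k i : ℝ) := by
      funext i
      simp [div_eq_inv_mul]
    rw [h1, Matrix.mulVec_smul, ← hk, inv_smul_smul₀ hN0]
  have hdot (m : Fin d → ℤ) : ∑ i, A.mulVec (fun j => (m j : ℝ)) i * z₀ i =
      ∑ i, (m i : ℝ) * ((k i : ℝ) / N) := by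
    rw [hz₀x]
    exact dotProduct_mulVec_mulVec_of_transpose_mul_eq_one hAB _ _
  obtain ⟨c, hc, hcor⟩ := exists_cos_autocorrelation_eq (by lia : 1 ≤ N) k
  refine ⟨c, hc, fun φ hφ => ?_⟩
  simp only [hdot] at hφ
  have hper (m : Fin d → ℤ) (i : Fin d) : φ (m + Pi.single i (N : ℤ)) = φ m := by
    have h1 : ∑ j, ((m + Pi.single i (N : ℤ) : Fin d → ℤ) j : ℝ) * ((k j : ℝ) / N) =
        ∑ j, (m j : ℝ) * ((k j : ℝ) / N) + k i := by
      simp only [Pi.add_apply, Int.cast_add, add_mul, Finset.sum_add_distrib, Pi.single_apply]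
      simp [mul_div_cancel₀ _ hN0]
    rw [hφ, hφ, h1, mul_add, mul_comm (2 * π) (k i : ℝ), Real.cos_add_int_mul_two_pi]
  have hcorφ (m : Fin d → ℤ) : ((N : ℝ) ^ d)⁻¹ *
      ∑ y ∈ Fintype.piFinset (fun _ : Fin d => Finset.Ico (0 : ℤ) (N : ℤ)), φ y * φ (y + m) =
      Real.cos (2 * π * ∑ i, (m i : ℝ) * ((k i : ℝ) / N)) := by
    simp only [hφ]
    exact hcor m
  refine ⟨hper, ?_, fun M hM ψ hψ hψ1 => ?_⟩
  · simpa [sq] using hcorφ 0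
  · rw [hE, hE, energy_eq_tsum_autocorrelation (by lia) hper hsum]
    simp only [hcorφ]
    refine le_energy_of_forall_le hM hψ hψ1 hsum fun x => ?_
    refine tsum_cos_mul_le_of_theta_le hd hAB hBdet hμf hf hsum fun α hα => ?_
    rw [← hz₀x]
    exact hz₀ α hα _
end

section
/- Let d ≥ 1, N ≥ 2, let A be an invertible real d×d matrix, and let f ∈ 𝓕 with ∑_{m∈ℤ^d∖{0}} f(Am) < ∞ and f not identically zero on ℝ^d∖{0}. If φ : ℤ^d → ℝ is N-periodic, satisfies the normalization N^{−d} ∑_{y∈K_N} φ(y)² = 1, and E_{X,f}[φ] ≤ E_{X,f}[ψ] for every N-periodic ψ satisfying the normalization, then the total net charge vanishes: ∑_{y∈K_N} φ(y) = 0. -/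
open scoped Real BigOperators
open MeasureTheory

/-- A function on `ℤ^d` that is periodic along each coordinate is invariant under
reduction of the coordinates modulo `N`. -/
theorem eq_emod_of_periodic {α : Type*} {d N : ℕ} {g : (Fin d → ℤ) → α}
    (hg : ∀ (m : Fin d → ℤ) (i : Fin d), g (m + Pi.single i (N : ℤ)) = g m)
    (x : Fin d → ℤ) : g (fun i => x i % N) = g x := by
  have key : ∀ (k : Fin d → ℤ) (s : Finset (Fin d)),
      Function.Periodic g (∑ i ∈ s, k i • Pi.single i (N : ℤ)) := by
    intro k s
    induction s using Finset.induction_on with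
    | empty => intro x; simp
    | insert i s hi ih =>
      rw [Finset.sum_insert hi]
      exact Function.Periodic.add_period (Function.Periodic.zsmul (fun m => hg m i) (k i)) ih
  rw [← key (fun i => x i / N) Finset.univ (fun i => x i % N)]
  congr 1
  funext j
  simp [Finset.sum_apply, Pi.single_apply, mul_comm, Int.emod_add_mul_ediv]

theorem emod_mem_box {d N : ℕ} (hN : 0 < N) (x : Fin d → ℤ) :
    (fun i => x i % (N : ℤ)) ∈ Fintype.piFinset fun _ : Fin d => Finset.Ico (0 : ℤ) (N : ℤ) := by
  have h : (0 : ℤ) < N := by exact_mod_cast hN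
  simp [Fintype.mem_piFinset, Int.emod_nonneg _ h.ne', Int.emod_lt_of_pos _ h]

theorem sum_box_translate {d N : ℕ} (hN : 0 < N) {g : (Fin d → ℤ) → ℝ}
    (hg : ∀ (m : Fin d → ℤ) (i : Fin d), g (m + Pi.single i (N : ℤ)) = g m)
    (m : Fin d → ℤ) :
    ∑ y ∈ Fintype.piFinset (fun _ : Fin d => Finset.Ico (0 : ℤ) (N : ℤ)), g (y + m) =
      ∑ y ∈ Fintype.piFinset (fun _ : Fin d => Finset.Ico (0 : ℤ) (N : ℤ)), g y := by
  have red : ∀ y ∈ Fintype.piFinset (fun _ : Fin d => Finset.Ico (0 : ℤ) (N : ℤ)),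
      ∀ i, y i % N = y i := by
    intro y hy i
    have := Finset.mem_Ico.1 (Fintype.mem_piFinset.1 hy i)
    exact Int.emod_eq_of_lt this.1 this.2
  refine Finset.sum_bij' (fun y _ i => (y + m) i % N) (fun y _ i => (y - m) i % N)
    (fun y _ => emod_mem_box hN _) (fun y _ => emod_mem_box hN _) ?_ ?_ ?_
  · intro y hy
    funext i
    simp [red y hy i]
  · intro y hy
    funext i
    simp [red y hy i]
  · intro y _
    exact (eq_emod_of_periodic hg (y + m)).symm

theorem exists_abs_le_of_periodic_s14 {d N : ℕ} (hN : 0 < N) {g : (Fin d → ℤ) → ℝ}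
    (hg : ∀ (m : Fin d → ℤ) (i : Fin d), g (m + Pi.single i (N : ℤ)) = g m) :
    ∃ B, ∀ x, |g x| ≤ B := by
  refine ⟨∑ y ∈ Fintype.piFinset (fun _ : Fin d => Finset.Ico (0 : ℤ) (N : ℤ)), |g y|,
    fun x => ?_⟩
  rw [← eq_emod_of_periodic hg x]
  exact Finset.single_le_sum (f := fun y => |g y|) (fun _ _ => abs_nonneg _) (emod_mem_box hN x)

theorem summable_mul_of_abs_le {ι : Type*} {c g : ι → ℝ} (hc : Summable c) {B : ℝ}
    (hg : ∀ m, |g m| ≤ B) : Summable fun m => c m * g m := by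
  refine Summable.of_norm_bounded (hc.norm.mul_right B) fun m => ?_
  rw [norm_mul]
  exact mul_le_mul_of_nonneg_left (hg m) (norm_nonneg _)

theorem summable_mul_sq_sub {d N : ℕ} (hN : 0 < N) {ι : Type*} {c : ι → ℝ} (hc : Summable c)
    (v : ι → Fin d → ℤ) {g : (Fin d → ℤ) → ℝ}
    (hg : ∀ (m : Fin d → ℤ) (i : Fin d), g (m + Pi.single i (N : ℤ)) = g m)
    (y : Fin d → ℤ) : Summable fun m => c m * (g y - g (y + v m)) ^ 2 := by
  obtain ⟨B, hB⟩ := exists_abs_le_of_periodic_s14 hN hg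
  refine summable_mul_of_abs_le hc (B := (B + B) ^ 2) fun m => ?_
  rw [abs_pow]
  gcongr
  exact (abs_sub _ _).trans (add_le_add (hB _) (hB _))

/-- The interaction energy is the self-energy minus half the Dirichlet form. -/
theorem sum_tsum_mul_eq_sub_dirichlet {d N : ℕ} (hN : 0 < N) {ι : Type*} {c : ι → ℝ}
    (hc : Summable c) (v : ι → Fin d → ℤ) {g : (Fin d → ℤ) → ℝ}
    (hg : ∀ (m : Fin d → ℤ) (i : Fin d), g (m + Pi.single i (N : ℤ)) = g m)
    (K : Finset (Fin d → ℤ))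
    (hK : K = Fintype.piFinset fun _ : Fin d => Finset.Ico (0 : ℤ) (N : ℤ)) :
    ∑ y ∈ K, ∑' m, g y * g (y + v m) * c m =
      (∑' m, c m) * ∑ y ∈ K, g y ^ 2 -
        2⁻¹ * ∑ y ∈ K, ∑' m, c m * (g y - g (y + v m)) ^ 2 := by
  obtain ⟨B, hB⟩ := exists_abs_le_of_periodic_s14 hN hg
  have h2 : ∀ y, Summable fun m => c m * g (y + v m) ^ 2 := fun y =>
    summable_mul_of_abs_le hc (B := B ^ 2) fun m => by
      rw [abs_pow]; gcongr; exact hB _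
  have h3 := summable_mul_sq_sub hN hc v hg
  have hswap : ∑ y ∈ K, ∑' m, c m * g (y + v m) ^ 2 = (∑' m, c m) * ∑ y ∈ K, g y ^ 2 := by
    rw [← Summable.tsum_finsetSum fun y _ => h2 y, ← tsum_mul_right]
    congr 1
    funext m
    rw [← Finset.mul_sum, hK, sum_box_translate hN (g := fun x => g x ^ 2)]
    intro m i
    simp only [hg]
  have hterm : ∀ y, ∑' m, g y * g (y + v m) * c m =
      2⁻¹ * ((∑' m, c m) * g y ^ 2 + ∑' m, c m * g (y + v m) ^ 2 -
        ∑' m, c m * (g y - g (y + v m)) ^ 2) := by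
    intro y
    rw [← tsum_mul_right, ← (hc.mul_right _).tsum_add (h2 y),
      ← ((hc.mul_right _).add (h2 y)).tsum_sub (h3 y), ← tsum_mul_left]
    congr 1
    funext m
    ring
  simp_rw [hterm]
  rw [← Finset.mul_sum, Finset.sum_sub_distrib, Finset.sum_add_distrib, hswap, ← Finset.mul_sum]
  ring

/-- Charge neutrality of minimizers in the summable case: if `f ∈ 𝓕` is summable on
`X∖{0}` and not identically zero, and the `N`-periodic normalized `φ` minimizes the
energy per particle among all `N`-periodic normalized configurations, then its total
net charge vanishes. -/
theorem minimizer_charge_neutral (d N : ℕ) (hd : 1 ≤ d) (hN : 2 ≤ N)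
    (A : Matrix (Fin d) (Fin d) ℝ) (hA : IsUnit A.det)
    (μ : Measure ℝ) (f : (Fin d → ℝ) → ℝ)
    (hμf : ∀ x : Fin d → ℝ, x ≠ 0 →
      IntegrableOn (fun t : ℝ => Real.exp (-(∑ i, x i ^ 2) * t)) (Set.Ici 0) μ)
    (hf : ∀ x : Fin d → ℝ, x ≠ 0 →
      f x = ∫ t in Set.Ici 0, Real.exp (-(∑ i, x i ^ 2) * t) ∂μ)
    (hsum : Summable fun m : {m : Fin d → ℤ // m ≠ 0} => f (A.mulVec fun j => (m.1 j : ℝ)))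
    (hfne : ∃ x : Fin d → ℝ, x ≠ 0 ∧ f x ≠ 0)
    (K : Finset (Fin d → ℤ)) (hK : K = Fintype.piFinset fun _ : Fin d => Finset.Ico (0 : ℤ) (N : ℤ))
    (E : ((Fin d → ℤ) → ℝ) → ℝ)
    (hE : ∀ χ : (Fin d → ℤ) → ℝ,
      E χ = (2 * (N : ℝ) ^ d)⁻¹ * ∑ y ∈ K, ∑' m : {m : Fin d → ℤ // m ≠ 0},
        χ y * χ (y + m.1) * f (A.mulVec fun j => (m.1 j : ℝ)))
    (φ : (Fin d → ℤ) → ℝ)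
    (hφ : ∀ (m : Fin d → ℤ) (i : Fin d), φ (m + Pi.single i (N : ℤ)) = φ m)
    (hnorm : ((N : ℝ) ^ d)⁻¹ * ∑ y ∈ K, φ y ^ 2 = 1)
    (hmin : ∀ ψ : (Fin d → ℤ) → ℝ,
      (∀ (m : Fin d → ℤ) (i : Fin d), ψ (m + Pi.single i (N : ℤ)) = ψ m) →
      ((N : ℝ) ^ d)⁻¹ * ∑ y ∈ K, ψ y ^ 2 = 1 →
      E φ ≤ E ψ) :
    ∑ y ∈ K, φ y = 0 := by
  have hN0 : 0 < N := by omega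
  have hP : (0 : ℝ) < (N : ℝ) ^ d := by positivity
  set c : {m : Fin d → ℤ // m ≠ 0} → ℝ := fun m => f (A.mulVec fun j => (m.1 j : ℝ)) with hc
  have hcpos : ∀ m, 0 < c m := by
    intro m
    have hμ : NeZero (μ.restrict (Set.Ici 0)) := by
      refine ⟨fun h0 => ?_⟩
      obtain ⟨x, hx, hfx⟩ := hfne
      exact hfx (by rw [hf x hx, h0, integral_zero_measure])
    have hx : (A.mulVec fun j => (m.1 j : ℝ)) ≠ 0 := by
      intro h0
      apply m.2
      have := Matrix.eq_zero_of_mulVec_eq_zero hA.ne_zero h0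
      funext j
      exact Int.cast_eq_zero.1 (congrFun this j)
    simp only [hc]
    rw [hf _ hx]
    exact integral_exp_pos (hμf _ hx)
  let D : ((Fin d → ℤ) → ℝ) → ℝ := fun χ =>
    ∑ y ∈ K, ∑' m : {m : Fin d → ℤ // m ≠ 0}, c m * (χ y - χ (y + m.1)) ^ 2
  have hmax : ∀ ψ : (Fin d → ℤ) → ℝ,
      (∀ (m : Fin d → ℤ) (i : Fin d), ψ (m + Pi.single i (N : ℤ)) = ψ m) →
      ((N : ℝ) ^ d)⁻¹ * ∑ y ∈ K, ψ y ^ 2 = 1 → D ψ ≤ D φ := by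
    intro ψ hψ hψn
    have h := hmin ψ hψ hψn
    rw [hE, hE, sum_tsum_mul_eq_sub_dirichlet hN0 hsum Subtype.val hφ K hK,
      sum_tsum_mul_eq_sub_dirichlet hN0 hsum Subtype.val hψ K hK] at h
    have h' := le_of_mul_le_mul_left h (by positivity)
    rw [mul_right_injective₀ (inv_ne_zero hP.ne') (hψn.trans hnorm.symm)] at h'
    change _ - 2⁻¹ * D φ ≤ _ - 2⁻¹ * D ψ at h'
    linarith
  have hDpos : 0 < D φ := by
    let ψ : (Fin d → ℤ) → ℝ := fun x => if ∀ i, (N : ℤ) ∣ x i then √((N : ℝ) ^ d) else 0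
    have h0K : (0 : Fin d → ℤ) ∈ K := by
      simp [hK, Fintype.mem_piFinset, hN0]
    have hψ : ∀ (m : Fin d → ℤ) (i : Fin d), ψ (m + Pi.single i (N : ℤ)) = ψ m := by
      intro m i
      have : ∀ j, ((N : ℤ) ∣ (m + Pi.single i (N : ℤ) : Fin d → ℤ) j) ↔ (N : ℤ) ∣ m j := by
        intro j
        refine (Int.dvd_add_left ?_)
        rcases eq_or_ne j i with rfl | hji
        · simp
        · simp [hji]
      simp only [ψ, this]
    have hψn : ((N : ℝ) ^ d)⁻¹ * ∑ y ∈ K, ψ y ^ 2 = 1 := by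
      rw [Finset.sum_eq_single_of_mem 0 h0K]
      · simp [ψ, Real.sq_sqrt hP.le, hP.ne']
      · intro y hy hy0
        rw [hK] at hy
        have : ¬ ∀ i, (N : ℤ) ∣ y i := by
          intro h
          apply hy0
          funext i
          have hi := Finset.mem_Ico.1 (Fintype.mem_piFinset.1 hy i)
          exact Int.eq_zero_of_dvd_of_nonneg_of_lt hi.1 hi.2 (h i)
        simp [ψ, this]
    refine lt_of_lt_of_le ?_ (hmax ψ hψ hψn)
    have hnn : ∀ (y : Fin d → ℤ) (m : {m : Fin d → ℤ // m ≠ 0}),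
        0 ≤ c m * (ψ y - ψ (y + m.1)) ^ 2 := fun y m =>
      mul_nonneg (hcpos m).le (sq_nonneg _)
    refine Finset.sum_pos' (fun y _ => tsum_nonneg (hnn y)) ⟨0, h0K, ?_⟩
    let e : {m : Fin d → ℤ // m ≠ 0} :=
      ⟨Pi.single ⟨0, hd⟩ 1, by simp⟩
    refine (summable_mul_sq_sub hN0 hsum Subtype.val hψ 0).tsum_pos (hnn 0) e ?_
    have h1 : ψ (0 + e.1) = 0 := by
      have : ¬ ∀ i, (N : ℤ) ∣ (0 + e.1) i := by
        intro h
        have := Int.le_of_dvd one_pos (by simpa [e] using h ⟨0, hd⟩)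
        omega
      simp only [ψ, if_neg this]
    have h2 : ψ 0 = √((N : ℝ) ^ d) := by simp [ψ]
    rw [h1, h2, sub_zero, Real.sq_sqrt hP.le]
    exact mul_pos (hcpos e) hP
  by_contra hS
  set a : ℝ := ((N : ℝ) ^ d)⁻¹ * ∑ y ∈ K, φ y with ha
  have ha0 : 0 < a ^ 2 := by
    have : a ≠ 0 := mul_ne_zero (inv_ne_zero hP.ne') hS
    positivity
  have hcard : (K.card : ℝ) = (N : ℝ) ^ d := by simp [hK]
  have hvar : ((N : ℝ) ^ d)⁻¹ * ∑ y ∈ K, (φ y - a) ^ 2 = 1 - a ^ 2 := by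
    have hexp : ∑ y ∈ K, (φ y - a) ^ 2 =
        ∑ y ∈ K, φ y ^ 2 - 2 * a * ∑ y ∈ K, φ y + (N : ℝ) ^ d * a ^ 2 := by
      simp only [sub_sq, Finset.sum_add_distrib, Finset.sum_sub_distrib, Finset.sum_const,
        nsmul_eq_mul, hcard, Finset.mul_sum]
      congr 2
      exact Finset.sum_congr rfl fun y _ => by ring
    have h1 : ((N : ℝ) ^ d)⁻¹ * (2 * a * ∑ y ∈ K, φ y) = 2 * a * a := by
      rw [ha]; ring
    rw [hexp, mul_add, mul_sub, hnorm, h1, inv_mul_cancel_left₀ hP.ne']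
    ring
  have hq : 0 < 1 - a ^ 2 := by
    refine lt_of_le_of_ne (hvar ▸ by positivity) fun h0 => hDpos.ne' ?_
    rw [← h0] at hvar
    have hz := (mul_eq_zero.1 hvar).resolve_left (inv_ne_zero hP.ne')
    rw [Finset.sum_eq_zero_iff_of_nonneg fun _ _ => sq_nonneg _] at hz
    have hconst : ∀ x, φ x = a := by
      intro x
      rw [← eq_emod_of_periodic hφ x]
      exact sub_eq_zero.1 (pow_eq_zero_iff two_ne_zero |>.1 (hz _ (hK ▸ emod_mem_box hN0 x)))
    simp [D, hconst]
  have hs : √(1 - a ^ 2) ^ 2 = 1 - a ^ 2 := Real.sq_sqrt hq.le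
  have hle := hmax (fun x => (φ x - a) / √(1 - a ^ 2)) (fun m i => by simp only [hφ]) (by
    simp only [div_pow, hs, ← Finset.sum_div]
    rw [← mul_div_assoc, hvar, div_self hq.ne'])
  have hscale : D (fun x => (φ x - a) / √(1 - a ^ 2)) = D φ / (1 - a ^ 2) := by
    simp only [D, Finset.sum_div, ← tsum_div_const]
    refine Finset.sum_congr rfl fun y _ => tsum_congr fun m => ?_
    rw [← sub_div, div_pow, hs, sub_sub_sub_cancel_right, mul_div_assoc]
  rw [hscale, div_le_iff₀ hq] at hle
  nlinarith [mul_pos hDpos ha0]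
end
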